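/- arXiv:1708.03919 — 6 statements merged into one kernel-verified Lean document; each statement's English description precedes it below -/
import Mathlib

section
/- Let α ≥ 2, and let μ, q_r, ρ_r, R₁ > 0 and θ_r ∈ [−π, π] be fixed. Let Y₀, Y₁, W be mutually independent random variables where Y₀ has probability density (1/q_r)e^{−y/q_r} on [0,∞), Y₁ has probability density e^{−y} on [0,∞), and W is uniformly distributed on the closed disc of radius R₁ centered at the origin in ℝ². Let x_r = (R₁cos θ_r, R₁sin θ_r) and d = ‖W − x_r‖. Then the probability of the event { d^α · Y₁ ≤ μ(ρ_r Y₀ + d^α)·‖W‖^α } equals (1/(πR₁²)) ∫₀^{R₁} ∫_{−π}^{π} ( 1 − exp(−μ r^α) / (1 + q_r ρ_r μ (R₁² + r² − 2rR₁cos(θ_r − θ))^{−α/2} r^α) ) · r dθ dr. -/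
open MeasureTheory Real Set

lemma aux_exp_Iic (c : ℝ) (hc : 0 ≤ c) :
    (volume.withDensity (fun y =>
      Set.indicator (Ici (0 : ℝ)) (fun y => ENNReal.ofReal (Real.exp (-y))) y)) (Iic c)
      = ENNReal.ofReal (1 - Real.exp (-c)) := by
  rw [withDensity_apply']
  have h := ProbabilityTheory.lintegral_exponentialPDF_eq_antiDeriv (r := 1) one_pos c
  rw [if_pos hc, one_mul] at h
  rw [← h]
  refine lintegral_congr fun y => ?_
  rw [ProbabilityTheory.exponentialPDF_eq]
  by_cases hy : 0 ≤ y <;> simp [Set.indicator, hy]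

lemma aux_exp_int (q A k : ℝ) (hq : 0 < q) (hA : 0 ≤ A) (hA1 : A ≤ 1) (hk : 0 ≤ k) :
    ∫⁻ y, ENNReal.ofReal (1 - A * Real.exp (-(k * y))) ∂(volume.withDensity (fun y =>
      Set.indicator (Ici (0 : ℝ))
        (fun y => ENNReal.ofReal ((1 / q) * Real.exp (-(y / q)))) y))
      = ENNReal.ofReal (1 - A / (1 + q * k)) := by
  have hm : Measurable (fun y : ℝ => Set.indicator (Ici (0 : ℝ))
        (fun y => ENNReal.ofReal ((1 / q) * Real.exp (-(y / q)))) y) :=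
    Measurable.indicator (by fun_prop) measurableSet_Ici
  rw [lintegral_withDensity_eq_lintegral_mul _ hm (by fun_prop)]
  have e1 : ∀ y : ℝ, ((fun y : ℝ => Set.indicator (Ici (0 : ℝ))
        (fun y => ENNReal.ofReal ((1 / q) * Real.exp (-(y / q)))) y) *
        (fun y => ENNReal.ofReal (1 - A * Real.exp (-(k * y))))) y =
      (Ici (0 : ℝ)).indicator (fun y => ENNReal.ofReal
        ((1 / q) * Real.exp ((-(1 / q)) * y) - (A / q) * Real.exp ((-(1 / q + k)) * y))) y := by
    intro y
    by_cases hy : y ∈ Ici (0 : ℝ)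
    · simp only [Pi.mul_apply, Set.indicator_of_mem hy]
      rw [← ENNReal.ofReal_mul (by positivity)]
      congr 1
      have : Real.exp ((-(1 / q + k)) * y) = Real.exp (-(y / q)) * Real.exp (-(k * y)) := by
        rw [← Real.exp_add]; congr 1; ring
      rw [this, show (-(1 / q)) * y = -(y / q) by ring]
      ring
    · simp only [Pi.mul_apply, Set.indicator_of_notMem hy, zero_mul]
  rw [lintegral_congr e1, lintegral_indicator measurableSet_Ici,
    setLIntegral_congr (Ioi_ae_eq_Ici (μ := volume) (a := (0 : ℝ))).symm]
  have hq' : -(1 / q) < 0 := by have : 0 < 1 / q := by positivity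
                                linarith
  have hqk : -(1 / q + k) < 0 := by linarith
  have i1 := (integrableOn_exp_mul_Ioi hq' 0).const_mul (1 / q)
  have i2 := (integrableOn_exp_mul_Ioi hqk 0).const_mul (A / q)
  have i3 : Integrable (fun y : ℝ => (1 / q) * Real.exp ((-(1 / q)) * y) -
      (A / q) * Real.exp ((-(1 / q + k)) * y)) (volume.restrict (Ioi 0)) := i1.sub i2
  rw [← ofReal_integral_eq_lintegral_ofReal i3]
  · rw [integral_sub i1 i2, integral_const_mul, integral_const_mul, integral_exp_mul_Ioi hq',
      integral_exp_mul_Ioi hqk]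
    congr 1
    simp only [mul_zero, Real.exp_zero]
    have h1 : 1 / q + k ≠ 0 := by linarith
    have h2 : 1 + q * k ≠ 0 := by positivity
    have h3 : 1 / q + k = (1 + q * k) / q := by field_simp
    rw [h3]
    field_simp
  · filter_upwards [ae_restrict_mem measurableSet_Ioi] with y hy
    have hy : 0 < y := hy
    have h1 : Real.exp ((-(1 / q + k)) * y) ≤ Real.exp ((-(1 / q)) * y) := by
      apply Real.exp_le_exp.2; nlinarith [mul_nonneg hk hy.le]
    have h2 : A / q ≤ 1 / q := by gcongr
    have := mul_le_mul h2 h1 (Real.exp_pos _).le (by positivity)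
    simpa using this

lemma aux_polar (f : EuclideanSpace ℝ (Fin 2) → ENNReal) :
    ∫⁻ w, f w = ∫⁻ p in Ioi (0 : ℝ) ×ˢ Ioo (-π) π,
      ENNReal.ofReal p.1 * f (!₂[p.1 * Real.cos p.2, p.1 * Real.sin p.2]) := by
  have h1 := (PiLp.volume_preserving_toLp (Fin 2)).lintegral_comp_emb
    (MeasurableEquiv.toLp 2 (Fin 2 → ℝ)).measurableEmbedding f
  have h2 := ((volume_preserving_finTwoArrow ℝ).symm).lintegral_comp_emb
    (MeasurableEquiv.finTwoArrow.symm.measurableEmbedding) (fun v => f (WithLp.toLp 2 v))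
  rw [← h1, ← h2, ← lintegral_comp_polarCoord_symm]
  rfl

/-- Proposition 1, RNRF near user: `Y₀`, `Y₁`, `W` are mutually independent,
`Y₀` exponential with mean `q_r`, `Y₁` exponential with mean `1`, `W` uniform on the closed
disc of radius `R₁` in `ℝ²`; `x_r = (R₁ cos θ_r, R₁ sin θ_r)` and `d = ‖W − x_r‖`. Then
`P(d^α Y₁ ≤ μ(ρ_r Y₀ + d^α)‖W‖^α)` equals the stated double integral. -/
theorem stmt_3
    {Ω : Type*} [MeasurableSpace Ω] (ℙ : Measure Ω) [IsProbabilityMeasure ℙ]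
    (α μ q_r ρ_r R₁ θ_r : ℝ)
    (hα : 2 ≤ α) (hμ : 0 < μ) (hq : 0 < q_r) (hρ : 0 < ρ_r) (hR : 0 < R₁)
    (hθ : θ_r ∈ Icc (-π) π)
    (Y₀ Y₁ : Ω → ℝ) (W : Ω → EuclideanSpace ℝ (Fin 2))
    (hY₀ : Measurable Y₀) (hY₁ : Measurable Y₁) (hW : Measurable W)
    (hjoint : Measure.map (fun ω => (Y₀ ω, Y₁ ω, W ω)) ℙ =
      (volume.withDensity (fun y =>
          Set.indicator (Ici (0 : ℝ))
            (fun y => ENNReal.ofReal ((1 / q_r) * Real.exp (-(y / q_r)))) y)).prod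
        ((volume.withDensity (fun y =>
            Set.indicator (Ici (0 : ℝ)) (fun y => ENNReal.ofReal (Real.exp (-y))) y)).prod
          (volume.withDensity (fun x =>
            Set.indicator (Metric.closedBall (0 : EuclideanSpace ℝ (Fin 2)) R₁)
              (fun _ => ENNReal.ofReal (1 / (π * R₁ ^ 2))) x))))
    (x_r : EuclideanSpace ℝ (Fin 2))
    (hx_r0 : x_r 0 = R₁ * Real.cos θ_r) (hx_r1 : x_r 1 = R₁ * Real.sin θ_r) :
    ℙ {ω | ‖W ω - x_r‖ ^ α * Y₁ ω ≤
        μ * (ρ_r * Y₀ ω + ‖W ω - x_r‖ ^ α) * ‖W ω‖ ^ α} =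
      ENNReal.ofReal ((1 / (π * R₁ ^ 2)) *
        ∫ r in (0 : ℝ)..R₁, ∫ θ in (-π)..π,
          (1 - Real.exp (-(μ * r ^ α)) /
              (1 + q_r * ρ_r * μ *
                (R₁ ^ 2 + r ^ 2 - 2 * r * R₁ * Real.cos (θ_r - θ)) ^ (-(α / 2)) * r ^ α)) *
            r) := by
  set ν₀ := (volume.withDensity (fun y =>
          Set.indicator (Ici (0 : ℝ))
            (fun y => ENNReal.ofReal ((1 / q_r) * Real.exp (-(y / q_r)))) y)) with hν₀
  set ν₁ := (volume.withDensity (fun y =>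
            Set.indicator (Ici (0 : ℝ)) (fun y => ENNReal.ofReal (Real.exp (-y))) y)) with hν₁
  set νW := (volume.withDensity (fun x =>
            Set.indicator (Metric.closedBall (0 : EuclideanSpace ℝ (Fin 2)) R₁)
              (fun _ => ENNReal.ofReal (1 / (π * R₁ ^ 2))) x)) with hνW
  have hα0 : 0 < α := by linarith
  let T : Set (ℝ × ℝ × EuclideanSpace ℝ (Fin 2)) :=
    {p | ‖p.2.2 - x_r‖ ^ α * p.2.1 ≤ μ * (ρ_r * p.1 + ‖p.2.2 - x_r‖ ^ α) * ‖p.2.2‖ ^ α}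
  have hT : MeasurableSet T := measurableSet_le (by fun_prop) (by fun_prop)
  let H : EuclideanSpace ℝ (Fin 2) → ℝ := fun w =>
    1 - Real.exp (-(μ * ‖w‖ ^ α)) /
      (1 + q_r * ρ_r * μ * (‖w - x_r‖ ^ 2) ^ (-(α / 2)) * ‖w‖ ^ α)
  have hHm : Measurable H := by fun_prop
  have step1 : ℙ {ω | ‖W ω - x_r‖ ^ α * Y₁ ω ≤
        μ * (ρ_r * Y₀ ω + ‖W ω - x_r‖ ^ α) * ‖W ω‖ ^ α} =
      ∫⁻ w, ∫⁻ y₀, ν₁ {y₁ | (y₀, y₁, w) ∈ T} ∂ν₀ ∂νW := by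
    have : {ω | ‖W ω - x_r‖ ^ α * Y₁ ω ≤
        μ * (ρ_r * Y₀ ω + ‖W ω - x_r‖ ^ α) * ‖W ω‖ ^ α} =
        (fun ω => (Y₀ ω, Y₁ ω, W ω)) ⁻¹' T := rfl
    rw [this, ← Measure.map_apply (by fun_prop) hT, hjoint, Measure.prod_apply hT]
    have h2 : ∀ y₀ : ℝ, (ν₁.prod νW) (Prod.mk y₀ ⁻¹' T) =
        ∫⁻ w, ν₁ {y₁ | (y₀, y₁, w) ∈ T} ∂νW := by
      intro y₀
      rw [Measure.prod_apply_symm (measurable_prodMk_left hT)]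
      rfl
    rw [lintegral_congr h2]
    apply lintegral_lintegral_swap
    have hT' : MeasurableSet {p : (ℝ × EuclideanSpace ℝ (Fin 2)) × ℝ |
        (p.1.1, p.2, p.1.2) ∈ T} := by
      have hm : Measurable (fun p : (ℝ × EuclideanSpace ℝ (Fin 2)) × ℝ =>
        (p.1.1, p.2, p.1.2)) := by fun_prop
      exact hm hT
    exact (measurable_measure_prodMk_left (ν := ν₁) hT').aemeasurable
  have step2 : ∀ w, w ≠ x_r → ∫⁻ y₀, ν₁ {y₁ | (y₀, y₁, w) ∈ T} ∂ν₀ = ENNReal.ofReal (H w) := by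
    intro w hw
    have hd : 0 < ‖w - x_r‖ := norm_pos_iff.2 (sub_ne_zero.2 hw)
    have hdα : 0 < ‖w - x_r‖ ^ α := Real.rpow_pos_of_pos hd _
    have hn : 0 ≤ ‖w‖ ^ α := Real.rpow_nonneg (norm_nonneg _) _
    set D := ‖w - x_r‖ ^ α with hD
    set N := ‖w‖ ^ α with hN
    have hDi : (‖w - x_r‖ ^ 2) ^ (-(α / 2)) = D⁻¹ := by
      rw [hD, ← Real.rpow_natCast, ← Real.rpow_mul hd.le, ← Real.rpow_neg hd.le]
      congr 1; push_cast; ring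
    have hae : ∀ᵐ y₀ ∂ν₀, ν₁ {y₁ | (y₀, y₁, w) ∈ T} =
        ENNReal.ofReal (1 - Real.exp (-(μ * N)) * Real.exp (-((ρ_r * μ * D⁻¹ * N) * y₀))) := by
      have hpos : ∀ᵐ y₀ ∂ν₀, 0 ≤ y₀ := by
        rw [hν₀, ae_withDensity_iff (Measurable.indicator (by fun_prop) measurableSet_Ici)]
        refine Filter.Eventually.of_forall fun y hy => ?_
        by_contra h
        exact hy (Set.indicator_of_notMem h _)
      filter_upwards [hpos] with y₀ hy
      have hset : {y₁ | (y₀, y₁, w) ∈ T} = Iic (μ * N + (ρ_r * μ * D⁻¹ * N) * y₀) := by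
        ext y₁
        change D * y₁ ≤ μ * (ρ_r * y₀ + D) * N ↔ y₁ ≤ _
        have : D * (μ * N + (ρ_r * μ * D⁻¹ * N) * y₀) = μ * (ρ_r * y₀ + D) * N := by
          field_simp
          ring
        rw [← this, mul_le_mul_iff_right₀ hdα]
      rw [hset, aux_exp_Iic _ (by positivity), ← Real.exp_add]
      congr 3; ring_nf
    rw [lintegral_congr_ae hae, aux_exp_int q_r _ _ hq (Real.exp_pos _).le
      (Real.exp_le_one_iff.2 (by have := mul_nonneg hμ.le hn; linarith)) (by positivity)]
    simp only [H]
    rw [hDi]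
    congr 4; ring
  have hCm : Measurable (fun x => Set.indicator (Metric.closedBall (0 : EuclideanSpace ℝ (Fin 2)) R₁)
              (fun _ => ENNReal.ofReal (1 / (π * R₁ ^ 2))) x) :=
    Measurable.indicator (by fun_prop) Metric.isClosed_closedBall.measurableSet
  have step3 : ∀ᵐ w ∂νW, w ≠ x_r := by
    have : ∀ᵐ w ∂(volume : Measure (EuclideanSpace ℝ (Fin 2))), w ≠ x_r := by
      simp [ae_iff]
    exact (withDensity_absolutelyContinuous _ _).ae_le this
  rw [step1, lintegral_congr_ae (step3.mono step2), hνW,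
    lintegral_withDensity_eq_lintegral_mul _ hCm (by fun_prop), aux_polar]
  let G : ℝ × ℝ → ℝ := fun p => (1 - Real.exp (-(μ * p.1 ^ α)) /
              (1 + q_r * ρ_r * μ *
                (R₁ ^ 2 + p.1 ^ 2 - 2 * p.1 * R₁ * Real.cos (θ_r - p.2)) ^ (-(α / 2)) * p.1 ^ α)) *
            p.1
  have hGm : Measurable G := by fun_prop
  have hsq : ∀ r θ : ℝ, ‖(!₂[r * Real.cos θ, r * Real.sin θ] : EuclideanSpace ℝ (Fin 2)) - x_r‖ ^ 2
      = R₁ ^ 2 + r ^ 2 - 2 * r * R₁ * Real.cos (θ_r - θ) := by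
    intro r θ
    rw [EuclideanSpace.norm_sq_eq]
    simp only [Fin.sum_univ_two, PiLp.sub_apply, hx_r0, hx_r1, Real.norm_eq_abs, sq_abs]
    simp
    rw [Real.cos_sub]
    linear_combination r ^ 2 * Real.sin_sq_add_cos_sq θ + R₁ ^ 2 * Real.sin_sq_add_cos_sq θ_r
  have hnorm : ∀ r θ : ℝ, 0 ≤ r →
      ‖(!₂[r * Real.cos θ, r * Real.sin θ] : EuclideanSpace ℝ (Fin 2))‖ = r := by
    intro r θ hr
    rw [← sq_eq_sq₀ (norm_nonneg _) hr, EuclideanSpace.norm_sq_eq]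
    simp only [Fin.sum_univ_two, Real.norm_eq_abs, sq_abs]
    simp
    linear_combination r ^ 2 * Real.sin_sq_add_cos_sq θ
  have hGb : ∀ r θ : ℝ, 0 ≤ r → 0 ≤ G (r, θ) ∧ G (r, θ) ≤ r := by
    intro r θ hr
    have h0 : 0 ≤ R₁ ^ 2 + r ^ 2 - 2 * r * R₁ * Real.cos (θ_r - θ) := by
      rw [← hsq]; positivity
    have h1 : 0 ≤ q_r * ρ_r * μ *
        (R₁ ^ 2 + r ^ 2 - 2 * r * R₁ * Real.cos (θ_r - θ)) ^ (-(α / 2)) * r ^ α := by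
      have := Real.rpow_nonneg h0 (-(α / 2))
      positivity
    have h2 : Real.exp (-(μ * r ^ α)) ≤ 1 := Real.exp_le_one_iff.2 (by
      have : 0 ≤ μ * r ^ α := by positivity
      linarith)
    have h3 : Real.exp (-(μ * r ^ α)) / (1 + q_r * ρ_r * μ *
        (R₁ ^ 2 + r ^ 2 - 2 * r * R₁ * Real.cos (θ_r - θ)) ^ (-(α / 2)) * r ^ α) ≤ 1 := by
      rw [div_le_one (by linarith)]; linarith
    have h4 : 0 ≤ Real.exp (-(μ * r ^ α)) / (1 + q_r * ρ_r * μ *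
        (R₁ ^ 2 + r ^ 2 - 2 * r * R₁ * Real.cos (θ_r - θ)) ^ (-(α / 2)) * r ^ α) :=
      div_nonneg (Real.exp_pos _).le (by linarith)
    refine ⟨mul_nonneg (by linarith) hr, ?_⟩
    exact mul_le_of_le_one_left hr (by linarith)
  have hmeasT : MeasurableSet (Ioi (0 : ℝ) ×ˢ Ioo (-π) π) :=
    measurableSet_Ioi.prod measurableSet_Ioo
  have hmeasS : MeasurableSet (Ioc (0 : ℝ) R₁ ×ˢ Ioo (-π) π) :=
    measurableSet_Ioc.prod measurableSet_Ioo
  have step4 : ∀ p ∈ Ioi (0 : ℝ) ×ˢ Ioo (-π) π, ENNReal.ofReal p.1 *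
      ((fun x => Set.indicator (Metric.closedBall (0 : EuclideanSpace ℝ (Fin 2)) R₁)
              (fun _ => ENNReal.ofReal (1 / (π * R₁ ^ 2))) x) * fun w => ENNReal.ofReal (H w))
          (!₂[p.1 * Real.cos p.2, p.1 * Real.sin p.2]) =
      (Ioc (0 : ℝ) R₁ ×ˢ Ioo (-π) π).indicator
        (fun p => ENNReal.ofReal (1 / (π * R₁ ^ 2)) * ENNReal.ofReal (G p)) p := by
    rintro ⟨r, θ⟩ ⟨hr, hθ'⟩
    have hr : 0 < r := hr
    have hθ' : θ ∈ Ioo (-π) π := hθ'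
    simp only [Pi.mul_apply]
    by_cases hrR : r ≤ R₁
    · rw [Set.indicator_of_mem (by rw [mem_closedBall_zero_iff, hnorm r θ hr.le]; exact hrR),
        Set.indicator_of_mem (show (r, θ) ∈ Ioc (0 : ℝ) R₁ ×ˢ Ioo (-π) π from ⟨⟨hr, hrR⟩, hθ'⟩)]
      have : G (r, θ) = H (!₂[r * Real.cos θ, r * Real.sin θ]) * r := by
        simp only [G, H]
        rw [hsq, hnorm r θ hr.le]
      rw [this, ENNReal.ofReal_mul' hr.le]
      ring
    · rw [Set.indicator_of_notMem (by rw [mem_closedBall_zero_iff, hnorm r θ hr.le]; exact hrR),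
        Set.indicator_of_notMem (fun h => hrR h.1.2)]
      simp
  rw [setLIntegral_congr_fun hmeasT step4, setLIntegral_indicator hmeasS,
    Set.inter_eq_left.2 (Set.prod_mono Ioc_subset_Ioi_self subset_rfl),
    lintegral_const_mul _ (by fun_prop), ENNReal.ofReal_mul (by positivity)]
  congr 1
  have hGi : IntegrableOn G (Ioc (0 : ℝ) R₁ ×ˢ Ioo (-π) π) := by
    apply Measure.integrableOn_of_bounded (M := R₁)
    · rw [Measure.volume_eq_prod, Measure.prod_prod]
      exact ENNReal.mul_ne_top (by simp) (by simp)
    · exact hGm.aestronglyMeasurable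
    · filter_upwards [ae_restrict_mem hmeasS] with p hp
      have := hGb p.1 p.2 hp.1.1.le
      rw [Real.norm_eq_abs, abs_of_nonneg this.1]
      exact this.2.trans hp.1.2
  rw [← ofReal_integral_eq_lintegral_ofReal hGi]
  · congr 1
    rw [Measure.volume_eq_prod, setIntegral_prod G hGi, intervalIntegral.integral_of_le hR.le]
    refine integral_congr_ae (Filter.Eventually.of_forall fun r => ?_)
    simp only []
    rw [intervalIntegral.integral_of_le (by linarith [Real.pi_pos]), integral_Ioc_eq_integral_Ioo]
  · filter_upwards [ae_restrict_mem hmeasS] with p hp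
    exact (hGb p.1 p.2 hp.1.1.le).1
end

section
/- Let α ≥ 2; let N_R ≥ 1 and N_T ≥ 2 be integers; let ρ_s, ρ_r, R₁ > 0; let 0 < R₂ < R₃; and let a₁, a₂, τ₂ > 0 with a₁τ₂ < a₂. Let Y₂, Y₃, R be mutually independent random variables where Y₂ has probability density x^{N_R−1}e^{−x}/(N_R−1)! on [0,∞), Y₃ has probability density x^{N_T−2}e^{−x}/(N_T−2)! on [0,∞), and R has probability density 2r/(R₃² − R₂²) on [R₂, R₃]. Set V = ρ_s R₁^{−α} Y₂, β = τ₂/ρ_r, ε_k = k + 2/α, b₃ = 2/(R₃² − R₂²), and c = τ₂R₁^α/(ρ_s(a₂ − τ₂a₁)). Then P( a₂V/(a₁V + 1) < τ₂ ) + P( a₂V/(a₁V + 1) > τ₂ ) · P( ρ_r R^{−α} Y₃ < τ₂ ) = 1 − (b₃/Γ(N_R)) · Γ(N_R, c) · Σ_{k=0}^{N_T−2} (β^{k−ε_k}/(k!·α)) · ( Γ(ε_k, βR₂^α) − Γ(ε_k, βR₃^α) ). -/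
open MeasureTheory Real Set

/-- The upper incomplete gamma function `Γ(a, x) = ∫_x^∞ t^{a−1} e^{−t} dt`. -/
noncomputable def upperGamma (a x : ℝ) : ℝ :=
  ∫ t in Set.Ioi x, t ^ (a - 1) * Real.exp (-t)

/-- Tail of the Erlang distribution. -/
noncomputable def erlTail (n : ℕ) (x : ℝ) : ℝ :=
  ∑ k ∈ Finset.range (n + 1), x ^ k / (Nat.factorial k : ℝ) * Real.exp (-x)

noncomputable def erlMeas (n : ℕ) : Measure ℝ :=
  volume.withDensity (fun x =>
          Set.indicator (Ici (0 : ℝ))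
            (fun x => ENNReal.ofReal
              (x ^ n * Real.exp (-x) / (Nat.factorial n : ℝ))) x)

noncomputable def radMeas (R₂ R₃ : ℝ) : Measure ℝ :=
  volume.withDensity (fun r =>
            Set.indicator (Icc R₂ R₃)
              (fun r => ENNReal.ofReal (2 * r / (R₃ ^ 2 - R₂ ^ 2))) r)

lemma erlTail_hasDerivAt (n : ℕ) (x : ℝ) :
    HasDerivAt (fun x => - erlTail n x) (x ^ n * Real.exp (-x) / (Nat.factorial n : ℝ)) x := by
  induction n with
  | zero =>
    have h : HasDerivAt (fun x : ℝ => Real.exp (-x)) (Real.exp (-x) * (-1)) x :=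
      (hasDerivAt_neg x).exp
    have h2 := h.fun_neg
    have e : (fun x => - erlTail 0 x) = fun x => - Real.exp (-x) := by
      funext y; simp [erlTail]
    rw [e]
    refine h2.congr_deriv ?_
    simp
  | succ n ih =>
    have h : HasDerivAt (fun x : ℝ => Real.exp (-x)) (Real.exp (-x) * (-1)) x :=
      (hasDerivAt_neg x).exp
    have h2 := ((hasDerivAt_pow (n + 1) x).div_const (Nat.factorial (n + 1) : ℝ)).mul h
    have h3 := ih.sub h2
    have e : (fun x => - erlTail (n + 1) x) = (fun x => - erlTail n x) -
        ((fun x : ℝ => x ^ (n + 1) / (Nat.factorial (n + 1) : ℝ)) * fun x => Real.exp (-x)) := by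
      funext y
      simp only [erlTail, Pi.sub_apply, Pi.mul_apply]
      rw [Finset.sum_range_succ _ (n + 1)]
      ring
    rw [e]
    refine h3.congr_deriv ?_
    have hn : (Nat.factorial n : ℝ) ≠ 0 := by positivity
    have hn1 : (n : ℝ) + 1 ≠ 0 := by positivity
    rw [Nat.factorial_succ]
    push_cast
    field_simp
    ring

lemma erlTail_tendsto (n : ℕ) :
    Filter.Tendsto (fun x => - erlTail n x) Filter.atTop (nhds 0) := by
  have : Filter.Tendsto (fun x => erlTail n x) Filter.atTop
      (nhds (∑ k ∈ Finset.range (n + 1), (0 : ℝ) / (Nat.factorial k : ℝ))) := by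
    unfold erlTail
    refine tendsto_finsetSum _ fun k _ => ?_
    have := (Real.tendsto_pow_mul_exp_neg_atTop_nhds_zero k).div_const (Nat.factorial k : ℝ)
    refine this.congr fun x => ?_
    ring
  simpa using this.neg

lemma erl_integrable (n : ℕ) {x : ℝ} (hx : 0 ≤ x) :
    IntegrableOn (fun t : ℝ => t ^ n * Real.exp (-t) / (Nat.factorial n : ℝ)) (Ioi x) :=
  integrableOn_Ioi_deriv_of_nonneg' (fun t _ => erlTail_hasDerivAt n t)
    (fun t ht => by have : 0 < t := lt_of_le_of_lt hx ht
                    positivity) (erlTail_tendsto n)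

lemma erl_integral (n : ℕ) {x : ℝ} (hx : 0 ≤ x) :
    ∫ t in Ioi x, t ^ n * Real.exp (-t) / (Nat.factorial n : ℝ) = erlTail n x := by
  have := integral_Ioi_of_hasDerivAt_of_nonneg' (a := x) (fun t _ => erlTail_hasDerivAt n t)
    (fun t ht => by have : 0 < t := lt_of_le_of_lt hx ht
                    positivity) (erlTail_tendsto n)
  rw [this]; ring

lemma erlMeas_Ioi (n : ℕ) {x : ℝ} (hx : 0 ≤ x) :
    erlMeas n (Ioi x) = ENNReal.ofReal (erlTail n x) := by
  unfold erlMeas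
  rw [withDensity_apply _ measurableSet_Ioi, ← erl_integral n hx,
    ofReal_integral_eq_lintegral_ofReal (erl_integrable n hx)]
  · refine setLIntegral_congr_fun measurableSet_Ioi fun t ht => ?_
    have : t ∈ Ici (0 : ℝ) := le_of_lt (lt_of_le_of_lt hx ht)
    simp only [indicator_of_mem this]
  · filter_upwards [ae_restrict_mem measurableSet_Ioi] with t ht
    have : 0 < t := lt_of_le_of_lt hx ht
    simp only [Pi.zero_apply]
    positivity

lemma erlMeas_Ici (n : ℕ) {x : ℝ} (hx : 0 ≤ x) :
    erlMeas n (Ici x) = ENNReal.ofReal (erlTail n x) := by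
  rw [← erlMeas_Ioi n hx]
  exact (measure_congr (Filter.EventuallyEq.filter_mono Ioi_ae_eq_Ici
    (withDensity_absolutelyContinuous _ _).ae_le)).symm

lemma erlTail_zero (n : ℕ) : erlTail n 0 = 1 := by
  simp [erlTail, Finset.sum_range_succ']

lemma erlMeas_Iio (n : ℕ) : erlMeas n (Iio 0) = 0 := by
  unfold erlMeas
  rw [withDensity_apply _ measurableSet_Iio, ← lintegral_zero (μ := volume.restrict (Iio (0:ℝ)))]
  refine setLIntegral_congr_fun measurableSet_Iio fun t ht => ?_
  have : t ∉ Ici (0 : ℝ) := fun h => absurd (mem_Iio.mp ht) (not_lt.mpr h)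
  simp only [indicator_of_notMem this]

instance erlMeas_prob (n : ℕ) : IsProbabilityMeasure (erlMeas n) := by
  constructor
  rw [← Iio_union_Ici (a := (0 : ℝ)), measure_union (by
    rw [Set.disjoint_left]; intro a h1 h2; exact absurd (mem_Iio.mp h1) (not_lt.mpr h2)) measurableSet_Ici,
    erlMeas_Iio, erlMeas_Ici n le_rfl, erlTail_zero]
  simp

lemma erlTail_nonneg (n : ℕ) {x : ℝ} (hx : 0 ≤ x) : 0 ≤ erlTail n x := by
  unfold erlTail; positivity

lemma radMeas_lintegral {R₂ R₃ : ℝ} (hR₂ : 0 < R₂) (hR₃ : R₂ < R₃) (f : ℝ → ℝ)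
    (g : ℝ → ENNReal) (hg : Measurable g)
    (hgf : ∀ r ∈ Icc R₂ R₃, g r = ENNReal.ofReal (f r))
    (hf : ContinuousOn f (Icc R₂ R₃)) (h0 : ∀ r ∈ Icc R₂ R₃, 0 ≤ f r) :
    ∫⁻ r, g r ∂(radMeas R₂ R₃) =
      ENNReal.ofReal (∫ r in R₂..R₃, 2 * r / (R₃ ^ 2 - R₂ ^ 2) * f r) := by
  have hd : 0 < R₃ ^ 2 - R₂ ^ 2 := by nlinarith
  unfold radMeas
  rw [lintegral_withDensity_eq_lintegral_mul _ _ hg]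
  · have : ((fun r => Set.indicator (Icc R₂ R₃)
              (fun r => ENNReal.ofReal (2 * r / (R₃ ^ 2 - R₂ ^ 2))) r) * g) =
        (Icc R₂ R₃).indicator
          (fun r => ENNReal.ofReal (2 * r / (R₃ ^ 2 - R₂ ^ 2) * f r)) := by
      funext r
      by_cases h : r ∈ Icc R₂ R₃
      · have : 0 ≤ 2 * r / (R₃ ^ 2 - R₂ ^ 2) := by
          have : 0 < r := hR₂.trans_le h.1
          positivity
        simp only [Pi.mul_apply, indicator_of_mem h, hgf r h]
        rw [ENNReal.ofReal_mul this]
      · simp only [Pi.mul_apply, indicator_of_notMem h, zero_mul]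
    rw [this, lintegral_indicator measurableSet_Icc,
      intervalIntegral.integral_of_le hR₃.le, ← integral_Icc_eq_integral_Ioc,
      ofReal_integral_eq_lintegral_ofReal]
    · exact ContinuousOn.integrableOn_Icc (by fun_prop)
    · filter_upwards [ae_restrict_mem measurableSet_Icc] with r h
      have h1 : 0 < r := hR₂.trans_le h.1
      have h2 := h0 r h
      simp only [Pi.zero_apply]
      positivity
  · exact Measurable.indicator (by fun_prop) measurableSet_Icc

lemma radMeas_prob {R₂ R₃ : ℝ} (hR₂ : 0 < R₂) (hR₃ : R₂ < R₃) :
    IsProbabilityMeasure (radMeas R₂ R₃) := by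
  have hd : 0 < R₃ ^ 2 - R₂ ^ 2 := by nlinarith
  constructor
  have := radMeas_lintegral hR₂ hR₃ (fun _ => 1) (fun _ => 1) measurable_const (by simp)
    continuousOn_const (by simp)
  rw [lintegral_one] at this
  rw [this]
  have e : (fun r : ℝ => 2 * r / (R₃ ^ 2 - R₂ ^ 2) * 1) = fun r => (2 / (R₃ ^ 2 - R₂ ^ 2)) * r := by
    funext r; ring
  rw [e, intervalIntegral.integral_const_mul, integral_id]
  rw [show 2 / (R₃ ^ 2 - R₂ ^ 2) * ((R₃ ^ 2 - R₂ ^ 2) / 2) = 1 by field_simp]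
  simp

lemma radMeas_compl (R₂ R₃ : ℝ) : radMeas R₂ R₃ (Icc R₂ R₃)ᶜ = 0 := by
  unfold radMeas
  rw [withDensity_apply _ measurableSet_Icc.compl,
    ← lintegral_zero (μ := volume.restrict (Icc R₂ R₃)ᶜ)]
  refine setLIntegral_congr_fun measurableSet_Icc.compl fun t ht => ?_
  simp only [indicator_of_notMem ht]

lemma upperGamma_nat (n : ℕ) (hn : 1 ≤ n) {x : ℝ} (hx : 0 ≤ x) :
    upperGamma n x / Real.Gamma n = erlTail (n - 1) x := by
  obtain ⟨m, rfl⟩ := Nat.exists_eq_add_of_le' hn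
  rw [← erl_integral _ hx, integral_div, upperGamma]
  simp [Real.Gamma_nat_eq_factorial]

lemma subst_k {α β R₂ R₃ : ℝ} (hα : 0 < α) (hβ : 0 < β) (hR₂ : 0 < R₂) (hR₃ : R₂ < R₃) (k : ℕ) :
    β ^ ((k : ℝ) - ((k : ℝ) + 2 / α)) / ((Nat.factorial k : ℝ) * α) *
              (upperGamma ((k : ℝ) + 2 / α) (β * R₂ ^ α) -
                upperGamma ((k : ℝ) + 2 / α) (β * R₃ ^ α)) =
    ∫ r in R₂..R₃, r * ((β * r ^ α) ^ k / (Nat.factorial k : ℝ) * Real.exp (-(β * r ^ α))) := by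
  have hpos : ∀ x ∈ uIcc R₂ R₃, 0 < x := by
    intro x hx
    rw [uIcc_of_le hR₃.le] at hx
    exact hR₂.trans_le hx.1
  unfold upperGamma
  rw [intervalIntegral.integral_Ioi_sub_Ioi]
  · rw [← intervalIntegral.integral_comp_mul_deriv' (f := fun r => β * r ^ α)
      (f' := fun r => β * (α * r ^ (α - 1))), ← intervalIntegral.integral_const_mul]
    · refine intervalIntegral.integral_congr fun r hr => ?_
      have hr0 := hpos r hr
      have hk : (Nat.factorial k : ℝ) ≠ 0 := by positivity
      simp only [Function.comp]
      have hb : 0 < β * r ^ α := by positivity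
      have e1 : (β * r ^ α) ^ ((k : ℝ) + 2 / α - 1) =
          (β * r ^ α) ^ k * (β ^ (2 / α) * r ^ (2:ℕ) / (β * r ^ α)) := by
        rw [rpow_sub hb, rpow_add hb, rpow_natCast, rpow_one, mul_rpow hβ.le (by positivity),
          ← rpow_mul hr0.le, mul_div_cancel₀ _ hα.ne', ← rpow_natCast r 2]
        push_cast
        ring
      have e2 : β ^ ((k : ℝ) - ((k : ℝ) + 2 / α)) = (β ^ (2 / α))⁻¹ := by
        rw [← rpow_neg hβ.le]; congr 1; ring
      have e3 : r ^ (α - 1) = r ^ α / r := by rw [rpow_sub hr0, rpow_one]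
      rw [e1, e2, e3]
      have h5 : β ^ (2 / α) ≠ 0 := by positivity
      have h6 : r ^ α ≠ 0 := by positivity
      field_simp
    · intro x hx
      exact (Real.hasDerivAt_rpow_const (Or.inl (hpos x hx).ne')).const_mul β
    · intro x hx
      have := (hpos x hx).ne'
      refine ContinuousAt.continuousWithinAt ?_
      fun_prop (disch := simp [this])
    · rintro _ ⟨x, hx, rfl⟩
      have h0 := hpos x hx
      have : β * x ^ α ≠ 0 := by positivity
      refine ContinuousAt.continuousWithinAt ?_
      fun_prop (disch := simp [this])
  · have := Real.GammaIntegral_convergent (s := (k : ℝ) + 2 / α) (by positivity)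
    have := this.mono_set (t := Ioi 0) (s := Ioi (β * R₂ ^ α)) (Ioi_subset_Ioi (by positivity))
    simpa only [mul_comm] using this
  · gcongr

/-- Proposition 2, RNRF far user: with `Y₂ ∼ χ²(2N_R)/2`, `Y₃ ∼ χ²(2(N_T−1))/2`,
`R` the distance of a user uniform on the annulus `[R₂, R₃]`, all mutually independent,
`V = ρ_s R₁^{−α} Y₂`, `β = τ₂/ρ_r`, `ε_k = k + 2/α`, `b₃ = 2/(R₃² − R₂²)`,
`c = τ₂R₁^α/(ρ_s(a₂ − τ₂a₁))`, one has
`P(a₂V/(a₁V+1) < τ₂) + P(a₂V/(a₁V+1) > τ₂)·P(ρ_r R^{−α} Y₃ < τ₂)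
  = 1 − (b₃/Γ(N_R)) Γ(N_R, c) Σ_{k=0}^{N_T−2} (β^{k−ε_k}/(k!α))(Γ(ε_k, βR₂^α) − Γ(ε_k, βR₃^α))`. -/
theorem stmt_8
    {Ω : Type*} [MeasurableSpace Ω] (ℙ : Measure Ω) [IsProbabilityMeasure ℙ]
    (α ρ_s ρ_r R₁ R₂ R₃ a₁ a₂ τ₂ : ℝ) (N_R N_T : ℕ)
    (hα : 2 ≤ α) (hNR : 1 ≤ N_R) (hNT : 2 ≤ N_T)
    (hρs : 0 < ρ_s) (hρr : 0 < ρ_r) (hR₁ : 0 < R₁) (hR₂ : 0 < R₂) (hR₃ : R₂ < R₃)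
    (ha₁ : 0 < a₁) (ha₂ : 0 < a₂) (hτ₂ : 0 < τ₂) (hord : a₁ * τ₂ < a₂)
    (Y₂ Y₃ R : Ω → ℝ)
    (hY₂ : Measurable Y₂) (hY₃ : Measurable Y₃) (hR : Measurable R)
    (hjoint : Measure.map (fun ω => (Y₂ ω, Y₃ ω, R ω)) ℙ =
      (volume.withDensity (fun x =>
          Set.indicator (Ici (0 : ℝ))
            (fun x => ENNReal.ofReal
              (x ^ (N_R - 1) * Real.exp (-x) / (Nat.factorial (N_R - 1) : ℝ))) x)).prod
        ((volume.withDensity (fun x =>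
            Set.indicator (Ici (0 : ℝ))
              (fun x => ENNReal.ofReal
                (x ^ (N_T - 2) * Real.exp (-x) / (Nat.factorial (N_T - 2) : ℝ))) x)).prod
          (volume.withDensity (fun r =>
            Set.indicator (Icc R₂ R₃)
              (fun r => ENNReal.ofReal (2 * r / (R₃ ^ 2 - R₂ ^ 2))) r))))
    (V : Ω → ℝ) (hV : V = fun ω => ρ_s * R₁ ^ (-α) * Y₂ ω)
    (β c : ℝ) (hβ : β = τ₂ / ρ_r) (hc : c = τ₂ * R₁ ^ α / (ρ_s * (a₂ - τ₂ * a₁))) :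
    ℙ {ω | a₂ * V ω / (a₁ * V ω + 1) < τ₂} +
      ℙ {ω | a₂ * V ω / (a₁ * V ω + 1) > τ₂} *
        ℙ {ω | ρ_r * R ω ^ (-α) * Y₃ ω < τ₂} =
      ENNReal.ofReal
        (1 - (2 / (R₃ ^ 2 - R₂ ^ 2)) / Real.Gamma N_R * upperGamma N_R c *
          ∑ k ∈ Finset.range (N_T - 1),
            β ^ ((k : ℝ) - ((k : ℝ) + 2 / α)) / ((Nat.factorial k : ℝ) * α) *
              (upperGamma ((k : ℝ) + 2 / α) (β * R₂ ^ α) -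
                upperGamma ((k : ℝ) + 2 / α) (β * R₃ ^ α))) := by
  have hα0 : 0 < α := by linarith
  have hβ0 : 0 < β := by rw [hβ]; positivity
  have hd : 0 < a₂ - τ₂ * a₁ := by linarith
  have hc0 : 0 ≤ c := by rw [hc]; positivity
  have hb : 0 < R₃ ^ 2 - R₂ ^ 2 := by nlinarith
  have := radMeas_prob hR₂ hR₃
  have hJm : Measurable (fun ω => (Y₂ ω, Y₃ ω, R ω)) := by fun_prop
  have hJ : Measure.map (fun ω => (Y₂ ω, Y₃ ω, R ω)) ℙ =
      (erlMeas (N_R - 1)).prod ((erlMeas (N_T - 2)).prod (radMeas R₂ R₃)) := hjoint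
  have P2 : ∀ S : Set ℝ, MeasurableSet S → ℙ (Y₂ ⁻¹' S) = erlMeas (N_R - 1) S := by
    intro S hS
    have h := Measure.map_apply (μ := ℙ) hJm (hS.prod MeasurableSet.univ)
    rw [hJ, Measure.prod_prod, measure_univ, mul_one] at h
    rw [h]
    congr 1
    ext ω
    simp
  have P3 : ∀ T : Set (ℝ × ℝ), MeasurableSet T →
      ℙ ((fun ω => (Y₃ ω, R ω)) ⁻¹' T) = (erlMeas (N_T - 2)).prod (radMeas R₂ R₃) T := by
    intro T hT
    have h := Measure.map_apply (μ := ℙ) hJm (MeasurableSet.univ.prod hT)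
    rw [hJ, Measure.prod_prod, measure_univ, one_mul] at h
    rw [h]
    congr 1
    ext ω
    simp
  have hae : ∀ᵐ ω ∂ℙ, 0 ≤ Y₂ ω := by
    rw [ae_iff]
    have h := P2 (Iio 0) measurableSet_Iio
    rw [erlMeas_Iio] at h
    rw [← h]
    congr 1
    ext ω
    simp
  have key : ∀ y : ℝ, 0 ≤ y →
      0 < a₁ * (ρ_s * R₁ ^ (-α) * y) + 1 ∧
      a₂ * (ρ_s * R₁ ^ (-α) * y) - τ₂ * (a₁ * (ρ_s * R₁ ^ (-α) * y) + 1) =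
        (y - c) * (ρ_s * (a₂ - τ₂ * a₁) / R₁ ^ α) := by
    intro y hy
    refine ⟨by positivity, ?_⟩
    have hP : R₁ ^ α ≠ 0 := by positivity
    rw [hc, rpow_neg hR₁.le]
    field_simp
    ring
  have hK : 0 < ρ_s * (a₂ - τ₂ * a₁) / R₁ ^ α := by positivity
  set p := erlTail (N_R - 1) c with hp
  have hp0 : 0 ≤ p := erlTail_nonneg _ hc0
  have E1 : ℙ {ω | a₂ * V ω / (a₁ * V ω + 1) < τ₂} = 1 - ENNReal.ofReal p := by
    have h1 : ℙ {ω | a₂ * V ω / (a₁ * V ω + 1) < τ₂} = ℙ (Y₂ ⁻¹' (Ici c)ᶜ) := by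
      refine measure_congr ?_
      filter_upwards [hae] with ω hω
      apply propext
      change a₂ * V ω / (a₁ * V ω + 1) < τ₂ ↔ ¬ (c ≤ Y₂ ω)
      obtain ⟨k1, k2⟩ := key _ hω
      rw [hV, div_lt_iff₀ k1, not_le, ← sub_neg, k2, ← sub_neg (a := Y₂ ω)]
      constructor
      · intro h; exact neg_of_mul_neg_left h hK.le
      · intro h; exact mul_neg_of_neg_of_pos h hK
    rw [h1, P2 _ measurableSet_Ici.compl, prob_compl_eq_one_sub measurableSet_Ici,
      erlMeas_Ici _ hc0]
  have E2 : ℙ {ω | a₂ * V ω / (a₁ * V ω + 1) > τ₂} = ENNReal.ofReal p := by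
    have h1 : ℙ {ω | a₂ * V ω / (a₁ * V ω + 1) > τ₂} = ℙ (Y₂ ⁻¹' (Ioi c)) := by
      refine measure_congr ?_
      filter_upwards [hae] with ω hω
      apply propext
      change τ₂ < a₂ * V ω / (a₁ * V ω + 1) ↔ c < Y₂ ω
      obtain ⟨k1, k2⟩ := key _ hω
      rw [hV, lt_div_iff₀ k1, ← sub_pos, k2, ← sub_pos (b := c)]
      exact mul_pos_iff_of_pos_right hK
    rw [h1, P2 _ measurableSet_Ioi, erlMeas_Ioi _ hc0]
  have hp1 : p ≤ 1 := by
    have : ENNReal.ofReal p ≤ 1 := by rw [← E2]; exact prob_le_one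
    exact ENNReal.ofReal_le_one.mp this
  set q := ∫ r in R₂..R₃, 2 * r / (R₃ ^ 2 - R₂ ^ 2) * erlTail (N_T - 2) (β * r ^ α) with hq
  have hq0 : 0 ≤ q := by
    refine intervalIntegral.integral_nonneg hR₃.le fun r hr => ?_
    have h1 : 0 < r := hR₂.trans_le hr.1
    have h2 := erlTail_nonneg (N_T - 2) (x := β * r ^ α) (by positivity)
    positivity
  have hTm : MeasurableSet {z : ℝ × ℝ | ρ_r * z.2 ^ (-α) * z.1 < τ₂} :=
    measurableSet_lt (by fun_prop) measurable_const
  have E3c : (erlMeas (N_T - 2)).prod (radMeas R₂ R₃)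
      {z : ℝ × ℝ | ρ_r * z.2 ^ (-α) * z.1 < τ₂}ᶜ = ENNReal.ofReal q := by
    rw [Measure.prod_apply_symm hTm.compl, hq]
    refine radMeas_lintegral hR₂ hR₃ (fun r => erlTail (N_T - 2) (β * r ^ α)) _
      (measurable_measure_prodMk_right hTm.compl) ?_ ?_ ?_
    · intro r hr
      have h1 : 0 < r := hR₂.trans_le hr.1
      rw [← erlMeas_Ici _ (by positivity)]
      congr 1
      ext y
      simp only [mem_preimage, mem_compl_iff, mem_ofPred_eq, not_lt, mem_Ici]
      have hP : 0 < r ^ α := by positivity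
      rw [hβ, rpow_neg h1.le]
      rw [show ρ_r * (r ^ α)⁻¹ * y = ρ_r * y / r ^ α by ring, le_div_iff₀ hP,
        show τ₂ / ρ_r * r ^ α = τ₂ * r ^ α / ρ_r by ring, div_le_iff₀ hρr, mul_comm y]
    · intro r hr
      have h1 : r ≠ 0 := (hR₂.trans_le hr.1).ne'
      refine ContinuousAt.continuousWithinAt ?_
      unfold erlTail
      fun_prop (disch := simp [h1])
    · intro r hr
      have h1 : 0 < r := hR₂.trans_le hr.1
      exact erlTail_nonneg _ (by positivity)
  have hq1 : q ≤ 1 := by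
    have : ENNReal.ofReal q ≤ 1 := by rw [← E3c]; exact prob_le_one
    exact ENNReal.ofReal_le_one.mp this
  have E3 : ℙ {ω | ρ_r * R ω ^ (-α) * Y₃ ω < τ₂} = 1 - ENNReal.ofReal q := by
    have h := P3 _ hTm
    rw [← E3c, ← prob_compl_eq_one_sub hTm.compl, compl_compl, ← h]
    rfl
  have hsum : (2 / (R₃ ^ 2 - R₂ ^ 2)) * ∑ k ∈ Finset.range (N_T - 1),
            β ^ ((k : ℝ) - ((k : ℝ) + 2 / α)) / ((Nat.factorial k : ℝ) * α) *
              (upperGamma ((k : ℝ) + 2 / α) (β * R₂ ^ α) -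
                upperGamma ((k : ℝ) + 2 / α) (β * R₃ ^ α)) = q := by
    rw [Finset.sum_congr rfl fun k _ => subst_k hα0 hβ0 hR₂ hR₃ k,
      ← intervalIntegral.integral_finsetSum, ← intervalIntegral.integral_const_mul, hq]
    · refine intervalIntegral.integral_congr fun r _ => ?_
      simp only [erlTail]
      rw [show N_T - 2 + 1 = N_T - 1 by omega, ← Finset.mul_sum]
      ring
    · intro k _
      refine ContinuousOn.intervalIntegrable fun r hr => ?_
      rw [uIcc_of_le hR₃.le] at hr
      have h1 : r ≠ 0 := (hR₂.trans_le hr.1).ne'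
      refine ContinuousAt.continuousWithinAt ?_
      fun_prop (disch := simp [h1])
  rw [E1, E2, E3]
  have hfin : (2 / (R₃ ^ 2 - R₂ ^ 2)) / Real.Gamma N_R * upperGamma N_R c *
          ∑ k ∈ Finset.range (N_T - 1),
            β ^ ((k : ℝ) - ((k : ℝ) + 2 / α)) / ((Nat.factorial k : ℝ) * α) *
              (upperGamma ((k : ℝ) + 2 / α) (β * R₂ ^ α) -
                upperGamma ((k : ℝ) + 2 / α) (β * R₃ ^ α)) = p * q := by
    rw [hp, ← upperGamma_nat N_R hNR hc0, ← hsum]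
    ring
  rw [hfin, ← ENNReal.ofReal_one, ← ENNReal.ofReal_sub _ hp0, ← ENNReal.ofReal_sub _ hq0,
    ← ENNReal.ofReal_mul hp0, ← ENNReal.ofReal_add (by linarith)
      (mul_nonneg hp0 (by linarith))]
  congr 1
  ring
end

section
/- Let N_T ≥ 2 be an integer, let β > 0, and let 0 < R₂ < R₃. Let Y₃ and R be independent random variables where Y₃ has probability density x^{N_T−2}e^{−x}/(N_T−2)! on [0,∞) and R has probability density 2r/(R₃² − R₂²) on [R₂, R₃]. Then P( Y₃ < β R² ) = 1 − (b₃/2) · Σ_{k=0}^{N_T−2} β^k · ( G(R₂) − G(R₃) ), where b₃ = 2/(R₃² − R₂²) and G(x) = e^{−βx²} · Σ_{j=0}^{k} x^{2j}/(j! · β^{k+1−j}). -/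
open MeasureTheory Real Set

/-- Upper tail of the Erlang distribution. -/
noncomputable def tailE (n : ℕ) (t : ℝ) : ℝ :=
  Real.exp (-t) * ∑ k ∈ Finset.range (n + 1), t ^ k / (Nat.factorial k : ℝ)

lemma hasDerivAt_tailE (n : ℕ) (t : ℝ) :
    HasDerivAt (tailE n) (-(t ^ n * Real.exp (-t) / (Nat.factorial n : ℝ))) t := by
  have hexp : HasDerivAt (fun t : ℝ => Real.exp (-t)) (-Real.exp (-t)) t := by
    simpa using (hasDerivAt_neg t).exp
  induction n with
  | zero =>
    have : tailE 0 = fun t => Real.exp (-t) := by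
      funext t; simp [tailE]
    rw [this]
    simpa using hexp
  | succ n ih =>
    have : tailE (n + 1) = fun t => tailE n t +
        Real.exp (-t) * (t ^ (n + 1) / (Nat.factorial (n + 1) : ℝ)) := by
      funext t
      simp only [tailE]
      rw [Finset.sum_range_succ _ (n + 1)]
      ring
    rw [this]
    have h2 : HasDerivAt (fun t : ℝ => t ^ (n + 1) / (Nat.factorial (n + 1) : ℝ))
        (((n + 1 : ℕ) : ℝ) * t ^ n / (Nat.factorial (n + 1) : ℝ)) t := by
      simpa using (hasDerivAt_pow (n + 1) t).div_const (Nat.factorial (n + 1) : ℝ)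
    refine HasDerivAt.congr_deriv (ih.add (hexp.mul h2)) ?_
    have h3 : (Nat.factorial n : ℝ) ≠ 0 := by positivity
    have h4 : ((n : ℝ) + 1) ≠ 0 := by positivity
    rw [Nat.factorial_succ]
    push_cast
    field_simp
    ring

lemma lintegral_ftc (a b : ℝ) (hab : a ≤ b) (f F : ℝ → ℝ) (hf : Continuous f)
    (hpos : ∀ x ∈ Icc a b, 0 ≤ f x) (hF : ∀ x, HasDerivAt F (f x) x) :
    ∫⁻ x in Icc a b, ENNReal.ofReal (f x) = ENNReal.ofReal (F b - F a) := by
  rw [← ofReal_integral_eq_lintegral_ofReal]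
  · rw [integral_Icc_eq_integral_Ioc, ← intervalIntegral.integral_of_le hab,
      intervalIntegral.integral_eq_sub_of_hasDerivAt (fun x _ => hF x)
        (hf.intervalIntegrable _ _)]
  · exact hf.integrableOn_Icc
  · exact (ae_restrict_iff' measurableSet_Icc).2 (Filter.Eventually.of_forall hpos)

lemma tailE_zero (n : ℕ) : tailE n 0 = 1 := by
  simp [tailE, Finset.sum_range_succ']

lemma tailE_le_one (n : ℕ) (t : ℝ) (ht : 0 ≤ t) : tailE n t ≤ 1 := by
  have h1 : ∑ k ∈ Finset.range (n + 1), t ^ k / (Nat.factorial k : ℝ) ≤ Real.exp t :=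
    Real.sum_le_exp_of_nonneg ht _
  calc tailE n t ≤ Real.exp (-t) * Real.exp t := by
        unfold tailE; gcongr
    _ = 1 := by rw [← Real.exp_add]; simp

lemma erlang_cdf (n : ℕ) (t : ℝ) (ht : 0 ≤ t) :
    (volume.withDensity (fun x =>
          Set.indicator (Ici (0 : ℝ))
            (fun x => ENNReal.ofReal
              (x ^ n * Real.exp (-x) / (Nat.factorial n : ℝ))) x)) (Iio t)
      = ENNReal.ofReal (1 - tailE n t) := by
  rw [withDensity_apply _ measurableSet_Iio, setLIntegral_indicator measurableSet_Ici,
    Ici_inter_Iio, setLIntegral_congr Ico_ae_eq_Icc,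
    lintegral_ftc 0 t ht _ (fun x => - tailE n x)]
  · rw [tailE_zero]; congr 1; ring
  · fun_prop
  · intro x hx
    have := hx.1
    positivity
  · intro x
    exact HasDerivAt.congr_deriv (hasDerivAt_tailE n x).neg (neg_neg _)

lemma G_eq (β : ℝ) (hβ : 0 < β) (k : ℕ) (x : ℝ) :
    Real.exp (-(β * x ^ 2)) *
      ∑ j ∈ Finset.range (k + 1), x ^ (2 * j) / ((Nat.factorial j : ℝ) * β ^ (k + 1 - j))
      = tailE k (β * x ^ 2) / β ^ (k + 1) := by
  unfold tailE
  rw [mul_div_assoc, Finset.sum_div]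
  congr 1
  refine Finset.sum_congr rfl fun j hj => ?_
  have hj' : j ≤ k + 1 := (Finset.mem_range.1 hj).le
  have h3 : (Nat.factorial j : ℝ) ≠ 0 := by positivity
  have : β ^ (k + 1) = β ^ (k + 1 - j) * β ^ j := by
    rw [← pow_add, Nat.sub_add_cancel hj']
  rw [this, mul_pow, ← pow_mul]
  field_simp

/-- Corollary 2, second-hop factor, RNRF far user, `α = 2`: with
`Y₃ ∼ χ²(2(N_T−1))/2` and `R` uniform-in-area on the annulus `[R₂, R₃]`, independent,
`P(Y₃ < βR²) = 1 − (b₃/2) Σ_{k=0}^{N_T−2} β^k (G_k(R₂) − G_k(R₃))` where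
`b₃ = 2/(R₃² − R₂²)` and `G_k(x) = e^{−βx²} Σ_{j=0}^k x^{2j}/(j! β^{k+1−j})`. -/
theorem stmt_10
    {Ω : Type*} [MeasurableSpace Ω] (ℙ : Measure Ω) [IsProbabilityMeasure ℙ]
    (β R₂ R₃ : ℝ) (N_T : ℕ)
    (hNT : 2 ≤ N_T) (hβ : 0 < β) (hR₂ : 0 < R₂) (hR₃ : R₂ < R₃)
    (Y₃ R : Ω → ℝ) (hY₃ : Measurable Y₃) (hR : Measurable R)
    (hjoint : Measure.map (fun ω => (Y₃ ω, R ω)) ℙ =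
      (volume.withDensity (fun x =>
          Set.indicator (Ici (0 : ℝ))
            (fun x => ENNReal.ofReal
              (x ^ (N_T - 2) * Real.exp (-x) / (Nat.factorial (N_T - 2) : ℝ))) x)).prod
        (volume.withDensity (fun r =>
          Set.indicator (Icc R₂ R₃)
            (fun r => ENNReal.ofReal (2 * r / (R₃ ^ 2 - R₂ ^ 2))) r)))
    (G : ℕ → ℝ → ℝ)
    (hG : G = fun k x => Real.exp (-(β * x ^ 2)) *
      ∑ j ∈ Finset.range (k + 1), x ^ (2 * j) / ((Nat.factorial j : ℝ) * β ^ (k + 1 - j))) :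
    ℙ {ω | Y₃ ω < β * R ω ^ 2} =
      ENNReal.ofReal
        (1 - (2 / (R₃ ^ 2 - R₂ ^ 2)) / 2 *
          ∑ k ∈ Finset.range (N_T - 1), β ^ k * (G k R₂ - G k R₃)) := by
  obtain ⟨n, rfl⟩ : ∃ n, N_T = n + 2 := ⟨N_T - 2, by omega⟩
  simp only [Nat.add_sub_cancel, show n + 2 - 1 = n + 1 by omega] at hjoint ⊢
  have hD : 0 < R₃ ^ 2 - R₂ ^ 2 := by nlinarith
  have hmeas : MeasurableSet {p : ℝ × ℝ | p.1 < β * p.2 ^ 2} :=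
    measurableSet_lt (by fun_prop) (by fun_prop)
  have h1 : ℙ {ω | Y₃ ω < β * R ω ^ 2} =
      Measure.map (fun ω => (Y₃ ω, R ω)) ℙ {p : ℝ × ℝ | p.1 < β * p.2 ^ 2} := by
    rw [Measure.map_apply (hY₃.prodMk hR) hmeas]; rfl
  rw [h1, hjoint, Measure.prod_apply_symm hmeas]
  have h2 : ∀ y : ℝ, ((fun x => (x, y)) ⁻¹' {p : ℝ × ℝ | p.1 < β * p.2 ^ 2})
      = Iio (β * y ^ 2) := fun y => rfl
  simp only [h2]
  have h3 : ∀ y : ℝ, _ := fun y => erlang_cdf n (β * y ^ 2) (by positivity)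
  simp only [h3]
  have hc : Continuous (tailE n) :=
    continuous_iff_continuousAt.2 fun x => (hasDerivAt_tailE n x).continuousAt
  rw [lintegral_withDensity_eq_lintegral_mul _
    (Measurable.indicator (by fun_prop) measurableSet_Icc)
    (by have := hc.measurable; fun_prop)]
  have h4 : ∀ r, ((fun r => Set.indicator (Icc R₂ R₃)
            (fun r => ENNReal.ofReal (2 * r / (R₃ ^ 2 - R₂ ^ 2))) r) *
        (fun r => ENNReal.ofReal (1 - tailE n (β * r ^ 2)))) r =
      Set.indicator (Icc R₂ R₃) (fun r => ENNReal.ofReal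
        (2 * r / (R₃ ^ 2 - R₂ ^ 2) * (1 - tailE n (β * r ^ 2)))) r := by
    intro r
    by_cases hr : r ∈ Icc R₂ R₃
    · have h0 : 0 ≤ r := hR₂.le.trans hr.1
      simp only [Pi.mul_apply, indicator_of_mem hr]
      rw [ENNReal.ofReal_mul (by positivity)]
    · simp [indicator_of_notMem hr]
  simp only [h4]
  rw [lintegral_indicator measurableSet_Icc, lintegral_ftc R₂ R₃ hR₃.le _
    (fun r => r ^ 2 / (R₃ ^ 2 - R₂ ^ 2) + (1 / (R₃ ^ 2 - R₂ ^ 2)) *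
      ∑ k ∈ Finset.range (n + 1), β ^ k * (tailE k (β * r ^ 2) / β ^ (k + 1)))]
  · subst hG
    simp only [G_eq β hβ, mul_sub, Finset.sum_sub_distrib]
    congr 1
    field_simp
    ring
  · fun_prop
  · intro r hr
    have h0 : 0 ≤ r := hR₂.le.trans hr.1
    have := tailE_le_one n (β * r ^ 2) (by positivity)
    exact mul_nonneg (by positivity) (by linarith)
  · intro r
    have hin : HasDerivAt (fun r : ℝ => β * r ^ 2) (β * (2 * r)) r := by
      simpa using (hasDerivAt_pow 2 r).const_mul β
    have hsq : HasDerivAt (fun r : ℝ => r ^ 2) (2 * r) r := by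
      simpa using hasDerivAt_pow 2 r
    have hk : ∀ k ∈ Finset.range (n + 1), HasDerivAt
        (fun r : ℝ => β ^ k * (tailE k (β * r ^ 2) / β ^ (k + 1)))
        (-(2 * r) * (Real.exp (-(β * r ^ 2)) * ((β * r ^ 2) ^ k / (Nat.factorial k : ℝ)))) r := by
      intro k _
      have h := (((hasDerivAt_tailE k (β * r ^ 2)).comp r hin).div_const
        (β ^ (k + 1))).const_mul (β ^ k)
      refine HasDerivAt.congr_deriv h ?_
      rw [pow_succ β k]
      field_simp
    have h5 := (hsq.div_const (R₃ ^ 2 - R₂ ^ 2)).add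
      ((HasDerivAt.fun_sum hk).const_mul (1 / (R₃ ^ 2 - R₂ ^ 2)))
    refine HasDerivAt.congr_deriv h5 ?_
    rw [← Finset.mul_sum, ← Finset.mul_sum]
    unfold tailE
    ring
end

section
/- Let α ≥ 2, and let μ, q_r, ρ_r, R₁, λ_n > 0 and θ_r ∈ [−π, π] be fixed. Let Y₀, Y₁, R, Θ be mutually independent random variables where Y₀ has probability density (1/q_r)e^{−y/q_r} on [0,∞), Y₁ has probability density e^{−y} on [0,∞), R has probability density υ_n · r · e^{−πλ_n r²} on [0, R₁] with υ_n = 2πλ_n/(1 − e^{−πλ_n R₁²}), and Θ is uniformly distributed on [−π, π]. Let d = (R₁² + R² − 2RR₁cos(θ_r − Θ))^{1/2}. Then the probability of the event { d^α · Y₁ ≤ μ(ρ_r Y₀ + d^α)·R^α } equals (υ_n/(2π)) ∫₀^{R₁} ∫_{−π}^{π} r e^{−πλ_n r²} · ( 1 − exp(−μ r^α) / (1 + q_r ρ_r μ (R₁² + r² − 2rR₁cos(θ_r − θ))^{−α/2} r^α) ) dθ dr. -/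
open MeasureTheory Real Set

theorem aux_one (t : ℝ) (ht : 0 ≤ t) :
    (volume.withDensity (fun y => Set.indicator (Ici (0 : ℝ))
      (fun y => ENNReal.ofReal (Real.exp (-y))) y)) (Iic t) = ENNReal.ofReal (1 - Real.exp (-t)) := by
  rw [withDensity_apply _ measurableSet_Iic, lintegral_indicator measurableSet_Ici,
    Measure.restrict_restrict measurableSet_Ici, Ici_inter_Iic,
    ← ofReal_integral_eq_lintegral_ofReal, integral_Icc_eq_integral_Ioc,
    ← intervalIntegral.integral_of_le ht]
  · congr 1
    rw [intervalIntegral.integral_comp_neg (fun x => Real.exp x)]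
    simp
  · exact (Continuous.integrableOn_Icc (by fun_prop))
  · exact Filter.Eventually.of_forall fun x => (Real.exp_pos _).le

theorem aux_two (q k c : ℝ) (hq : 0 < q) (hk : 0 ≤ k) (hc0 : 0 ≤ c) (hc1 : c ≤ 1) :
    ∫⁻ y in Ici (0 : ℝ), ENNReal.ofReal ((1 / q) * Real.exp (-(y / q))) *
      ENNReal.ofReal (1 - c * Real.exp (-(k * y))) = ENNReal.ofReal (1 - c / (1 + q * k)) := by
  have hb : 0 < 1 / q + k := by positivity
  have h1 : IntegrableOn (fun y : ℝ => Real.exp (-(1 / q) * y)) (Ioi 0) :=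
    exp_neg_integrableOn_Ioi 0 (by positivity)
  have h2 : IntegrableOn (fun y : ℝ => Real.exp (-(1 / q + k) * y)) (Ioi 0) :=
    exp_neg_integrableOn_Ioi 0 hb
  have key : ∀ y : ℝ, (1 / q) * Real.exp (-(y / q)) * (1 - c * Real.exp (-(k * y))) =
      (1 / q) * Real.exp (-(1 / q) * y) - (c / q) * Real.exp (-(1 / q + k) * y) := by
    intro y
    have : Real.exp (-(1 / q + k) * y) = Real.exp (-(y / q)) * Real.exp (-(k * y)) := by
      rw [← Real.exp_add]; congr 1; ring
    rw [this, show -(1 / q) * y = -(y / q) by ring]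
    ring
  have e : ∀ a : ℝ, 0 < a → ∫ y in Ioi (0 : ℝ), Real.exp (-a * y) = 1 / a := by
    intro a ha
    rw [integral_exp_mul_Ioi (by linarith)]
    simp
  calc _ = ∫⁻ y in Ioi (0 : ℝ), ENNReal.ofReal
        ((1 / q) * Real.exp (-(1 / q) * y) - (c / q) * Real.exp (-(1 / q + k) * y)) := by
        rw [setLIntegral_congr Ioi_ae_eq_Ici.symm]
        refine lintegral_congr fun y => ?_
        rw [← ENNReal.ofReal_mul (by positivity), key]
    _ = ENNReal.ofReal (∫ y in Ioi (0 : ℝ),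
        ((1 / q) * Real.exp (-(1 / q) * y) - (c / q) * Real.exp (-(1 / q + k) * y))) := by
        rw [ofReal_integral_eq_lintegral_ofReal]
        · exact (h1.const_mul _).sub (h2.const_mul _)
        · filter_upwards [ae_restrict_mem measurableSet_Ioi] with y hy
          rw [← key]
          have hy' : (0 : ℝ) < y := hy
          have : Real.exp (-(k * y)) ≤ 1 := Real.exp_le_one_iff.2 (by nlinarith)
          have h3 : c * Real.exp (-(k * y)) ≤ 1 := mul_le_one₀ hc1 (Real.exp_pos _).le this
          have h4 : 0 ≤ 1 - c * Real.exp (-(k * y)) := by linarith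
          simp only [Pi.zero_apply]
          positivity
    _ = _ := by
        rw [integral_sub (h1.const_mul _) (h2.const_mul _), integral_const_mul, integral_const_mul,
          e _ (by positivity), e _ hb]
        congr 1
        have : 1 + q * k ≠ 0 := by positivity
        field_simp

theorem aux_three (q ρ μ t D : ℝ) (hq : 0 < q) (hρ : 0 < ρ) (hμ : 0 < μ) (ht : 0 ≤ t) (hD : 0 < D) :
    ∫⁻ y₀, (volume.withDensity (fun y => Set.indicator (Ici (0 : ℝ))
      (fun y => ENNReal.ofReal (Real.exp (-y))) y)) {y | D * y ≤ μ * (ρ * y₀ + D) * t}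
      ∂(volume.withDensity (fun y =>
          Set.indicator (Ici (0 : ℝ))
            (fun y => ENNReal.ofReal ((1 / q) * Real.exp (-(y / q)))) y)) =
    ENNReal.ofReal (1 - Real.exp (-(μ * t)) / (1 + q * ρ * μ * D⁻¹ * t)) := by
  have hs : ∀ y₀ : ℝ, {y | D * y ≤ μ * (ρ * y₀ + D) * t} = Iic (μ * (ρ * y₀ + D) * t / D) := by
    intro y₀
    ext y
    simp only [mem_ofPred_eq, mem_Iic]
    rw [le_div_iff₀ hD, mul_comm]
  simp only [hs]
  rw [lintegral_withDensity_eq_lintegral_mul_non_measurable]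
  rotate_left
  · exact Measurable.indicator (by fun_prop) measurableSet_Ici
  · refine Filter.Eventually.of_forall fun y => ?_
    by_cases hy : y ∈ Ici (0 : ℝ)
    · simp only [indicator_of_mem hy]; exact ENNReal.ofReal_lt_top
    · simp [indicator_of_notMem hy]
  have hk : 0 ≤ ρ * μ * D⁻¹ * t := by positivity
  rw [show q * ρ * μ * D⁻¹ * t = q * (ρ * μ * D⁻¹ * t) by ring,
    ← aux_two q _ _ hq hk (Real.exp_pos _).le (Real.exp_le_one_iff.2 (by nlinarith)),
    ← lintegral_indicator measurableSet_Ici]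
  refine lintegral_congr fun y => ?_
  by_cases hy : y ∈ Ici (0 : ℝ)
  · simp only [indicator_of_mem hy, Pi.mul_apply]
    have hy' : (0 : ℝ) ≤ y := hy
    rw [aux_one _ (by positivity), ← Real.exp_add]
    congr 5
    field_simp
    ring
  · simp [indicator_of_notMem hy]

theorem aux_four (a b R₁ q ρ : ℝ) (U : ℝ) (hU : 0 ≤ U) (α μ θ_r lam : ℝ) (hq : 0 < q) (hρ : 0 < ρ)
    (hμ : 0 < μ) (hR₁ : 0 < R₁) (hab : a ≤ b) (hlam : 0 < lam) (hα : 2 ≤ α)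
    (c : ℝ) (hc : 0 ≤ c) (D : ℝ → ℝ → ℝ) (hD : ∀ r θ, 0 ≤ D r θ)
    (hDm : Measurable (Function.uncurry D)) (G : ℝ → ℝ → ℝ)
    (hG : G = fun r θ => (1 - Real.exp (-(μ * r ^ α)) / (1 + q * ρ * μ * D r θ * r ^ α))) :
    ∫⁻ r in Ioc 0 R₁, ENNReal.ofReal (U * r * Real.exp (-(π * lam * r ^ 2))) *
      ∫⁻ θ in Ioc a b, ENNReal.ofReal c * ENNReal.ofReal (G r θ) =
    ENNReal.ofReal ((U * c) * ∫ r in (0 : ℝ)..R₁, ∫ θ in a..b,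
      r * Real.exp (-(π * lam * r ^ 2)) * G r θ) := by
  have hGm : Measurable (Function.uncurry G) := by
    subst hG
    have : Measurable (fun p : ℝ × ℝ => D p.1 p.2) := hDm
    unfold Function.uncurry
    fun_prop
  have hGb : ∀ r θ, 0 < r → 0 ≤ G r θ ∧ G r θ ≤ 1 := by
    intro r θ hr
    subst hG
    have h0 := hD r θ
    have h1 : 0 ≤ r ^ α := by positivity
    have h2 : 0 ≤ q * ρ * μ * D r θ * r ^ α := by positivity
    have h3 : Real.exp (-(μ * r ^ α)) ≤ 1 := Real.exp_le_one_iff.2 (by nlinarith)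
    have h4 : Real.exp (-(μ * r ^ α)) / (1 + q * ρ * μ * D r θ * r ^ α) ≤ 1 := by
      rw [div_le_one (by linarith)]; linarith
    have h5 : 0 ≤ Real.exp (-(μ * r ^ α)) / (1 + q * ρ * μ * D r θ * r ^ α) := by positivity
    constructor <;> simp only <;> linarith
  set F : ℝ × ℝ → ℝ := fun p => p.1 * Real.exp (-(π * lam * p.1 ^ 2)) * G p.1 p.2 with hF
  have hGm' : Measurable (fun p : ℝ × ℝ => G p.1 p.2) := hGm
  have hFm : Measurable F := by fun_prop
  have hmem : ∀ᵐ p ∂((volume.restrict (Ioc 0 R₁)).prod (volume.restrict (Ioc a b))),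
      p ∈ Ioc 0 R₁ ×ˢ Ioc a b := by
    rw [Measure.prod_restrict]
    exact ae_restrict_mem (measurableSet_Ioc.prod measurableSet_Ioc)
  have hF0 : ∀ᵐ p ∂((volume.restrict (Ioc 0 R₁)).prod (volume.restrict (Ioc a b))), 0 ≤ F p := by
    filter_upwards [hmem] with p hp
    have h1 : 0 < p.1 := hp.1.1
    have := (hGb p.1 p.2 h1).1
    simp only [hF]
    positivity
  have hFi : Integrable F ((volume.restrict (Ioc 0 R₁)).prod (volume.restrict (Ioc a b))) := by
    refine Integrable.of_bound hFm.aestronglyMeasurable R₁ ?_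
    filter_upwards [hmem, hF0] with p hp h0
    rw [Real.norm_of_nonneg h0]
    have h1 : 0 < p.1 := hp.1.1
    have h1' : p.1 ≤ R₁ := hp.1.2
    obtain ⟨g0, g1⟩ := hGb p.1 p.2 h1
    have h3 : Real.exp (-(π * lam * p.1 ^ 2)) ≤ 1 := Real.exp_le_one_iff.2 (by
      have := Real.pi_pos
      have : 0 ≤ π * lam * p.1 ^ 2 := by positivity
      linarith)
    calc F p ≤ p.1 * 1 * 1 := by simp only [hF]; gcongr
      _ ≤ R₁ := by linarith
  have e1 : ∫ r in (0 : ℝ)..R₁, ∫ θ in a..b, r * Real.exp (-(π * lam * r ^ 2)) * G r θ =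
      ∫ p, F p ∂((volume.restrict (Ioc 0 R₁)).prod (volume.restrict (Ioc a b))) := by
    rw [integral_prod _ hFi, intervalIntegral.integral_of_le hR₁.le]
    simp only [intervalIntegral.integral_of_le hab, hF]
  rw [e1, ENNReal.ofReal_mul (by positivity), ofReal_integral_eq_lintegral_ofReal hFi hF0,
    lintegral_prod _ (by fun_prop), ← lintegral_const_mul _ (by fun_prop)]
  refine setLIntegral_congr_fun measurableSet_Ioc fun r hr => ?_
  have hr0 : 0 < r := hr.1
  beta_reduce
  rw [← lintegral_const_mul _ (by fun_prop), ← lintegral_const_mul _ (by fun_prop)]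
  refine lintegral_congr fun θ => ?_
  have := (hGb r θ hr0).1
  rw [← ENNReal.ofReal_mul hc, ← ENNReal.ofReal_mul (by positivity),
    ← ENNReal.ofReal_mul (by positivity)]
  congr 1
  simp only [hF]
  ring

theorem aux_swap (ν₀ ν₁ ν₂ ν₃ : Measure ℝ) [SFinite ν₀] [SFinite ν₁] [SFinite ν₂] [SFinite ν₃]
    (S : Set (ℝ × ℝ × ℝ × ℝ)) (hS : MeasurableSet S) :
    (ν₀.prod (ν₁.prod (ν₂.prod ν₃))) S =
      ∫⁻ r, ∫⁻ θ, ∫⁻ y₀, ν₁ {y | (y₀, y, r, θ) ∈ S} ∂ν₀ ∂ν₃ ∂ν₂ := by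
  have hm : Measurable (fun z : ℝ × (ℝ × ℝ) => ν₁ {y | (z.1, y, z.2) ∈ S}) := by
    have : MeasurableSet ((fun w : (ℝ × (ℝ × ℝ)) × ℝ => (w.1.1, w.2, w.1.2)) ⁻¹' S) :=
      (by fun_prop : Measurable (fun w : (ℝ × (ℝ × ℝ)) × ℝ => (w.1.1, w.2, w.1.2))) hS
    exact measurable_measure_prodMk_left this
  rw [Measure.prod_apply hS]
  have h1 : ∀ y₀, (ν₁.prod (ν₂.prod ν₃)) (Prod.mk y₀ ⁻¹' S) =
      ∫⁻ p, ν₁ {y | (y₀, y, p) ∈ S} ∂(ν₂.prod ν₃) := by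
    intro y₀
    rw [Measure.prod_apply_symm (measurable_prodMk_left hS)]
    rfl
  simp only [h1]
  rw [lintegral_lintegral_swap hm.aemeasurable]
  exact lintegral_prod _ (hm.lintegral_prod_left').aemeasurable

/-- Proposition 3, NNNF near user: `Y₀`, `Y₁`, `R`, `Θ` mutually independent,
`Y₀` exponential with mean `q_r`, `Y₁` exponential with mean `1`, `R` with density
`υ_n r e^{−πlam_n r²}` on `[0, R₁]` (`υ_n = 2πlam_n/(1 − e^{−πlam_n R₁²})`), `Θ` uniform on `[−π, π]`,
and `d = (R₁² + R² − 2RR₁cos(θ_r − Θ))^{1/2}`. Then `P(d^α Y₁ ≤ μ(ρ_r Y₀ + d^α)R^α)` equals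
the stated double integral. -/
theorem stmt_11
    {Ω : Type*} [MeasurableSpace Ω] (ℙ : Measure Ω) [IsProbabilityMeasure ℙ]
    (α μ q_r ρ_r R₁ lam_n θ_r : ℝ)
    (hα : 2 ≤ α) (hμ : 0 < μ) (hq : 0 < q_r) (hρ : 0 < ρ_r) (hR₁ : 0 < R₁)
    (hlam : 0 < lam_n) (hθ : θ_r ∈ Icc (-π) π)
    (υ_n : ℝ) (hυ : υ_n = 2 * π * lam_n / (1 - Real.exp (-(π * lam_n * R₁ ^ 2))))
    (Y₀ Y₁ R Θ : Ω → ℝ)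
    (hY₀ : Measurable Y₀) (hY₁ : Measurable Y₁) (hR : Measurable R) (hTheta : Measurable Θ)
    (hjoint : Measure.map (fun ω => (Y₀ ω, Y₁ ω, R ω, Θ ω)) ℙ =
      (volume.withDensity (fun y =>
          Set.indicator (Ici (0 : ℝ))
            (fun y => ENNReal.ofReal ((1 / q_r) * Real.exp (-(y / q_r)))) y)).prod
        ((volume.withDensity (fun y =>
            Set.indicator (Ici (0 : ℝ)) (fun y => ENNReal.ofReal (Real.exp (-y))) y)).prod
          ((volume.withDensity (fun r =>
              Set.indicator (Icc (0 : ℝ) R₁)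
                (fun r => ENNReal.ofReal (υ_n * r * Real.exp (-(π * lam_n * r ^ 2)))) r)).prod
            (volume.withDensity (fun θ =>
              Set.indicator (Icc (-π) π)
                (fun _ => ENNReal.ofReal (1 / (2 * π))) θ)))))
    (d : Ω → ℝ)
    (hd : d = fun ω =>
      Real.sqrt (R₁ ^ 2 + R ω ^ 2 - 2 * R ω * R₁ * Real.cos (θ_r - Θ ω))) :
    ℙ {ω | d ω ^ α * Y₁ ω ≤ μ * (ρ_r * Y₀ ω + d ω ^ α) * R ω ^ α} =
      ENNReal.ofReal ((υ_n / (2 * π)) *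
        ∫ r in (0 : ℝ)..R₁, ∫ θ in (-π)..π,
          r * Real.exp (-(π * lam_n * r ^ 2)) *
            (1 - Real.exp (-(μ * r ^ α)) /
              (1 + q_r * ρ_r * μ *
                (R₁ ^ 2 + r ^ 2 - 2 * r * R₁ * Real.cos (θ_r - θ)) ^ (-(α / 2)) * r ^ α))) := by
  have hpi := Real.pi_pos
  have hυ0 : 0 < υ_n := by
    rw [hυ]
    have : Real.exp (-(π * lam_n * R₁ ^ 2)) < 1 := Real.exp_lt_one_iff.2 (by
      have : 0 < π * lam_n * R₁ ^ 2 := by positivity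
      linarith)
    have h2 : 0 < 1 - Real.exp (-(π * lam_n * R₁ ^ 2)) := by linarith
    positivity
  set Q : ℝ → ℝ → ℝ := fun r θ => R₁ ^ 2 + r ^ 2 - 2 * r * R₁ * Real.cos (θ_r - θ) with hQ
  have hQ0 : ∀ r θ, 0 ≤ Q r θ := by
    intro r θ
    simp only [hQ]
    nlinarith [sq_nonneg (R₁ - r * Real.cos (θ_r - θ)), Real.sin_sq_add_cos_sq (θ_r - θ),
      mul_nonneg (sq_nonneg r) (sq_nonneg (Real.sin (θ_r - θ)))]
  have hQpos : ∀ r θ, 0 < r → r < R₁ → 0 < Q r θ := by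
    intro r θ h1 h2
    simp only [hQ]
    have : 0 < (R₁ - r) ^ 2 := by have : 0 < R₁ - r := by linarith
                                  positivity
    have h3 : 0 ≤ r * R₁ * (1 - Real.cos (θ_r - θ)) :=
      mul_nonneg (by positivity) (by linarith [Real.cos_le_one (θ_r - θ)])
    nlinarith
  set S : Set (ℝ × ℝ × ℝ × ℝ) := {z | √(Q z.2.2.1 z.2.2.2) ^ α * z.2.1 ≤
    μ * (ρ_r * z.1 + √(Q z.2.2.1 z.2.2.2) ^ α) * z.2.2.1 ^ α} with hSdef
  have hS : MeasurableSet S := by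
    simp only [hSdef, hQ]
    exact measurableSet_le (by fun_prop) (by fun_prop)
  have hmap : ℙ {ω | d ω ^ α * Y₁ ω ≤ μ * (ρ_r * Y₀ ω + d ω ^ α) * R ω ^ α} =
      Measure.map (fun ω => (Y₀ ω, Y₁ ω, R ω, Θ ω)) ℙ S := by
    rw [Measure.map_apply (by fun_prop) hS, hd]
    rfl
  rw [hmap, hjoint, aux_swap _ _ _ _ _ hS]
  rw [lintegral_withDensity_eq_lintegral_mul_non_measurable]
  rotate_left
  · exact Measurable.indicator (by fun_prop) measurableSet_Icc
  · refine Filter.Eventually.of_forall fun y => ?_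
    by_cases hy : y ∈ Icc 0 R₁
    · simp only [indicator_of_mem hy]; exact ENNReal.ofReal_lt_top
    · simp [indicator_of_notMem hy]
  have key := aux_four (-π) π R₁ q_r ρ_r υ_n hυ0.le α μ θ_r lam_n hq hρ hμ hR₁ (by linarith) hlam hα
    (1 / (2 * π)) (by positivity) (fun r θ => Q r θ ^ (-(α / 2)))
    (fun r θ => Real.rpow_nonneg (hQ0 r θ) _) (by
      unfold Function.uncurry
      simp only [hQ]
      fun_prop) _ rfl
  rw [show υ_n / (2 * π) = υ_n * (1 / (2 * π)) by ring]
  refine Eq.trans ?_ key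
  rw [← restrict_Ioo_eq_restrict_Ioc, ← lintegral_indicator measurableSet_Ioo]
  have hne0 : ∀ᵐ r : ℝ, r ≠ 0 := by simp [ae_iff]
  have hne1 : ∀ᵐ r : ℝ, r ≠ R₁ := by simp [ae_iff]
  refine lintegral_congr_ae ?_
  filter_upwards [hne0, hne1] with r hr0 hr1
  by_cases hr : r ∈ Ioo 0 R₁
  · simp only [indicator_of_mem hr, indicator_of_mem (Ioo_subset_Icc_self hr), Pi.mul_apply]
    congr 1
    rw [lintegral_withDensity_eq_lintegral_mul_non_measurable]
    rotate_left
    · exact Measurable.indicator (by fun_prop) measurableSet_Icc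
    · refine Filter.Eventually.of_forall fun y => ?_
      by_cases hy : y ∈ Icc (-π) π
      · simp only [indicator_of_mem hy]; exact ENNReal.ofReal_lt_top
      · simp [indicator_of_notMem hy]
    rw [restrict_Ioc_eq_restrict_Icc, ← lintegral_indicator measurableSet_Icc]
    refine lintegral_congr fun θ => ?_
    by_cases hy : θ ∈ Icc (-π) π
    · simp only [indicator_of_mem hy, Pi.mul_apply]
      congr 1
      have hq0 := hQpos r θ hr.1 hr.2
      have e1 : √(Q r θ) ^ α = Q r θ ^ (α / 2) := by
        rw [Real.sqrt_eq_rpow, ← Real.rpow_mul hq0.le]; congr 1; ring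
      have := aux_three q_r ρ_r μ (r ^ α) (Q r θ ^ (α / 2)) hq hρ hμ
        (Real.rpow_nonneg hr.1.le _) (Real.rpow_pos_of_pos hq0 _)
      rw [Real.rpow_neg hq0.le, ← this]
      simp only [hSdef, mem_ofPred_eq, e1]
    · simp [indicator_of_notMem hy]
  · have : r ∉ Icc 0 R₁ := fun h => hr ⟨lt_of_le_of_ne h.1 (Ne.symm hr0), lt_of_le_of_ne h.2 hr1⟩
    simp [indicator_of_notMem hr, indicator_of_notMem this]
end

section
/- Let α ≥ 2; let N_R ≥ 1 and N_T ≥ 2 be integers; let ρ_s, ρ_r, R₁, λ_f > 0; let 0 < R₂ < R₃; and let a₁, a₂, τ₂ > 0 with a₁τ₂ < a₂. Let Y₂, Y₃, R be mutually independent random variables where Y₂ has probability density x^{N_R−1}e^{−x}/(N_R−1)! on [0,∞), Y₃ has probability density x^{N_T−2}e^{−x}/(N_T−2)! on [0,∞), and R has probability density υ_f · r · e^{−πλ_f(r² − R₂²)} on [R₂, R₃] with υ_f = 2πλ_f/(1 − e^{−πλ_f(R₃² − R₂²)}). Set V = ρ_s R₁^{−α} Y₂, β = τ₂/ρ_r,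 and c = τ₂R₁^α/(ρ_s(a₂ − τ₂a₁)). Then P( a₂V/(a₁V + 1) < τ₂ ) + P( a₂V/(a₁V + 1) > τ₂ ) · P( ρ_r R^{−α} Y₃ < τ₂ ) = 1 − (Γ(N_R, c)/Γ(N_R)) · υ_f e^{πλ_f R₂²} · Σ_{k=0}^{N_T−2} (β^k/k!) · ∫_{R₂}^{R₃} r^{αk+1} e^{−(β r^α + πλ_f r²)} dr. -/
open MeasureTheory Real Set

lemma gam_deriv (n : ℕ) (x : ℝ) :
    HasDerivAt (fun t : ℝ => -(Real.exp (-t) * ∑ k ∈ Finset.range (n + 1), t ^ k / (k.factorial : ℝ)))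
      (x ^ n * Real.exp (-x) / (n.factorial : ℝ)) x := by
  induction n with
  | zero =>
    simp only [zero_add, Finset.range_one, Finset.sum_singleton, pow_zero, Nat.factorial_zero,
      Nat.cast_one, div_one, mul_one, one_mul]
    have h := ((hasDerivAt_neg x).exp).neg
    refine h.congr_deriv ?_
    simp
  | succ n ih =>
    have h1 : HasDerivAt (fun t : ℝ => Real.exp (-t) * (t ^ (n + 1) / ((n + 1).factorial : ℝ)))
        (Real.exp (-x) * (-1) * (x ^ (n + 1) / ((n + 1).factorial : ℝ)) +
          Real.exp (-x) * (((n + 1 : ℕ) : ℝ) * x ^ n / ((n + 1).factorial : ℝ))) x := by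
      have := (hasDerivAt_pow (n + 1) x).div_const ((n + 1).factorial : ℝ)
      exact ((hasDerivAt_neg x).exp).mul this
    have h2 := ih.sub h1
    refine (h2.congr_deriv ?_).congr_of_eventuallyEq (Filter.Eventually.of_forall fun t => ?_)
    · have : ((n.factorial : ℕ) : ℝ) ≠ 0 := by positivity
      rw [Nat.factorial_succ]
      push_cast
      field_simp
      ring
    · simp only [Pi.sub_apply]
      rw [Finset.sum_range_succ _ (n + 1)]
      ring

lemma gam_tendsto (n : ℕ) :
    Filter.Tendsto (fun t : ℝ => -(Real.exp (-t) * ∑ k ∈ Finset.range (n + 1), t ^ k / (k.factorial : ℝ)))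
      Filter.atTop (nhds 0) := by
  have h : ∀ k ∈ Finset.range (n + 1), Filter.Tendsto
      (fun t : ℝ => (t ^ k * Real.exp (-t)) / (k.factorial : ℝ)) Filter.atTop (nhds 0) := by
    intro k _
    simpa using (Real.tendsto_pow_mul_exp_neg_atTop_nhds_zero k).div_const (k.factorial : ℝ)
  have := (tendsto_finsetSum _ h).neg
  simp only [Finset.sum_const_zero, neg_zero] at this
  refine this.congr fun t => ?_
  rw [Finset.mul_sum]
  congr 1
  exact Finset.sum_congr rfl fun k _ => by ring

lemma gam_int (n : ℕ) (x : ℝ) (hx : 0 ≤ x) :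
    IntegrableOn (fun t : ℝ => t ^ n * Real.exp (-t) / (n.factorial : ℝ)) (Ioi x) :=
  integrableOn_Ioi_deriv_of_nonneg' (fun t _ => gam_deriv n t)
    (fun t ht => by
      have : 0 < t := lt_of_le_of_lt hx ht
      positivity) (gam_tendsto n)

lemma gam_val (n : ℕ) (x : ℝ) (hx : 0 ≤ x) :
    ∫ t in Ioi x, t ^ n * Real.exp (-t) / (n.factorial : ℝ) =
      Real.exp (-x) * ∑ k ∈ Finset.range (n + 1), x ^ k / (k.factorial : ℝ) := by
  rw [integral_Ioi_of_hasDerivAt_of_nonneg' (fun t _ => gam_deriv n t)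
    (fun t ht => by
      have : 0 < t := lt_of_le_of_lt hx ht
      positivity) (gam_tendsto n)]
  ring

noncomputable def gamM (n : ℕ) : Measure ℝ :=
  volume.withDensity (fun x => Set.indicator (Ici (0 : ℝ))
    (fun x => ENNReal.ofReal (x ^ n * Real.exp (-x) / (n.factorial : ℝ))) x)

lemma gamM_Ioi (n : ℕ) (x : ℝ) (hx : 0 ≤ x) :
    gamM n (Ioi x) = ENNReal.ofReal
      (Real.exp (-x) * ∑ k ∈ Finset.range (n + 1), x ^ k / (k.factorial : ℝ)) := by
  rw [gamM, withDensity_apply _ measurableSet_Ioi, ← gam_val n x hx,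
    ofReal_integral_eq_lintegral_ofReal (gam_int n x hx)]
  · refine setLIntegral_congr_fun measurableSet_Ioi fun t ht => ?_
    have : t ∈ Ici (0 : ℝ) := le_trans hx (le_of_lt ht)
    simp only [indicator_of_mem this]
  · refine (ae_restrict_iff' measurableSet_Ioi).2 (Filter.Eventually.of_forall fun t ht => ?_)
    have : 0 < t := lt_of_le_of_lt hx ht
    simp only [Pi.zero_apply]
    positivity

lemma gamM_ac (n : ℕ) : gamM n ≪ volume := withDensity_absolutelyContinuous _ _

lemma gamM_ae (n : ℕ) : ∀ᵐ x ∂gamM n, 0 ≤ x := by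
  rw [ae_iff]
  have : {a : ℝ | ¬ 0 ≤ a} = Iio 0 := by ext; simp
  rw [this, gamM, withDensity_apply _ measurableSet_Iio]
  rw [setLIntegral_congr_fun (g := fun _ => 0) measurableSet_Iio]
  · simp
  · intro t ht
    have : t ∉ Ici (0 : ℝ) := by simpa using ht
    simp only [indicator_of_notMem this]

lemma gamM_Ici (n : ℕ) (x : ℝ) (hx : 0 ≤ x) :
    gamM n (Ici x) = ENNReal.ofReal
      (Real.exp (-x) * ∑ k ∈ Finset.range (n + 1), x ^ k / (k.factorial : ℝ)) := by
  rw [← gamM_Ioi n x hx]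
  have h : Ioi x =ᵐ[gamM n] Ici x := (gamM_ac n).ae_le Ioi_ae_eq_Ici
  exact measure_congr h.symm

instance gamM_prob (n : ℕ) : IsProbabilityMeasure (gamM n) := by
  constructor
  have h : gamM n univ = gamM n (Ici 0) := by
    refine measure_congr ?_
    filter_upwards [gamM_ae n] with x hx
    exact propext ⟨fun _ => hx, fun _ => trivial⟩
  rw [h, gamM_Ici n 0 le_rfl, Finset.sum_range_succ']
  simp

lemma gamM_Iio (n : ℕ) (x : ℝ) : gamM n (Iio x) = 1 - gamM n (Ici x) := by
  rw [← prob_compl_eq_one_sub measurableSet_Ici, compl_Ici]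

lemma key_iff {a₁ a₂ τ₂ κ ρ_s R₁ α y : ℝ} (hρs : 0 < ρ_s) (hR₁ : 0 < R₁)
    (ha₁ : 0 < a₁) (hord : a₁ * τ₂ < a₂) (hy : 0 ≤ y) (hκ : κ = ρ_s * R₁ ^ (-α)) :
    (a₂ * (κ * y) / (a₁ * (κ * y) + 1) < τ₂ ↔
      y < τ₂ * R₁ ^ α / (ρ_s * (a₂ - τ₂ * a₁))) ∧
    (τ₂ < a₂ * (κ * y) / (a₁ * (κ * y) + 1) ↔
      τ₂ * R₁ ^ α / (ρ_s * (a₂ - τ₂ * a₁)) < y) := by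
  have hp : 0 < R₁ ^ α := Real.rpow_pos_of_pos hR₁ α
  have hκ0 : κ * R₁ ^ α = ρ_s := by
    rw [hκ, Real.rpow_neg hR₁.le]; field_simp
  have hκp : 0 < κ := by
    rw [hκ]; have := Real.rpow_pos_of_pos hR₁ (-α); positivity
  have hd : 0 < a₂ - τ₂ * a₁ := by linarith
  have hden : 0 < a₁ * (κ * y) + 1 := by positivity
  rw [div_lt_iff₀ hden, lt_div_iff₀ hden, lt_div_iff₀ (by positivity), div_lt_iff₀ (by positivity)]
  rw [← hκ0]
  have e : y * (κ * R₁ ^ α * (a₂ - τ₂ * a₁)) = (y * κ * (a₂ - τ₂ * a₁)) * R₁ ^ α := by ring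
  rw [e, mul_lt_mul_iff_left₀ hp, mul_lt_mul_iff_left₀ hp]
  constructor <;> constructor <;> intro h <;> nlinarith

/-- Proposition 4, NNNF far user, exact form: with `Y₂ ∼ χ²(2N_R)/2`,
`Y₃ ∼ χ²(2(N_T−1))/2`, `R` the distance of the nearest far user with density
`υ_f r e^{−πλ_f(r² − R₂²)}` on `[R₂, R₃]`, all mutually independent,
`V = ρ_s R₁^{−α} Y₂`, `β = τ₂/ρ_r`, `c = τ₂R₁^α/(ρ_s(a₂ − τ₂a₁))`, one has
`P(a₂V/(a₁V+1) < τ₂) + P(a₂V/(a₁V+1) > τ₂)·P(ρ_r R^{−α} Y₃ < τ₂)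
  = 1 − (Γ(N_R, c)/Γ(N_R)) υ_f e^{πλ_f R₂²} Σ_{k=0}^{N_T−2} (β^k/k!)
      ∫_{R₂}^{R₃} r^{αk+1} e^{−(βr^α + πλ_f r²)} dr`. -/
theorem stmt_13
    {Ω : Type*} [MeasurableSpace Ω] (ℙ : Measure Ω) [IsProbabilityMeasure ℙ]
    (α ρ_s ρ_r R₁ R₂ R₃ a₁ a₂ τ₂ lam_f : ℝ) (N_R N_T : ℕ)
    (hα : 2 ≤ α) (hNR : 1 ≤ N_R) (hNT : 2 ≤ N_T)
    (hρs : 0 < ρ_s) (hρr : 0 < ρ_r) (hR₁ : 0 < R₁) (hR₂ : 0 < R₂) (hR₃ : R₂ < R₃)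
    (ha₁ : 0 < a₁) (ha₂ : 0 < a₂) (hτ₂ : 0 < τ₂) (hord : a₁ * τ₂ < a₂) (hlam : 0 < lam_f)
    (υ_f : ℝ) (hυ : υ_f = 2 * π * lam_f / (1 - Real.exp (-(π * lam_f * (R₃ ^ 2 - R₂ ^ 2)))))
    (Y₂ Y₃ R : Ω → ℝ)
    (hY₂ : Measurable Y₂) (hY₃ : Measurable Y₃) (hR : Measurable R)
    (hjoint : Measure.map (fun ω => (Y₂ ω, Y₃ ω, R ω)) ℙ =
      (volume.withDensity (fun x =>
          Set.indicator (Ici (0 : ℝ))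
            (fun x => ENNReal.ofReal
              (x ^ (N_R - 1) * Real.exp (-x) / (Nat.factorial (N_R - 1) : ℝ))) x)).prod
        ((volume.withDensity (fun x =>
            Set.indicator (Ici (0 : ℝ))
              (fun x => ENNReal.ofReal
                (x ^ (N_T - 2) * Real.exp (-x) / (Nat.factorial (N_T - 2) : ℝ))) x)).prod
          (volume.withDensity (fun r =>
            Set.indicator (Icc R₂ R₃)
              (fun r => ENNReal.ofReal
                (υ_f * r * Real.exp (-(π * lam_f * (r ^ 2 - R₂ ^ 2))))) r))))
    (V : Ω → ℝ) (hV : V = fun ω => ρ_s * R₁ ^ (-α) * Y₂ ω)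
    (β c : ℝ) (hβ : β = τ₂ / ρ_r) (hc : c = τ₂ * R₁ ^ α / (ρ_s * (a₂ - τ₂ * a₁))) :
    ℙ {ω | a₂ * V ω / (a₁ * V ω + 1) < τ₂} +
      ℙ {ω | a₂ * V ω / (a₁ * V ω + 1) > τ₂} *
        ℙ {ω | ρ_r * R ω ^ (-α) * Y₃ ω < τ₂} =
      ENNReal.ofReal
        (1 - upperGamma N_R c / Real.Gamma N_R *
          (υ_f * Real.exp (π * lam_f * R₂ ^ 2)) *
          ∑ k ∈ Finset.range (N_T - 1),
            β ^ k / (Nat.factorial k : ℝ) *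
              ∫ r in R₂..R₃,
                r ^ (α * k + 1) * Real.exp (-(β * r ^ α + π * lam_f * r ^ 2))) := by
  obtain ⟨n, rfl⟩ : ∃ n, N_R = n + 1 := ⟨N_R - 1, by omega⟩
  obtain ⟨m, rfl⟩ : ∃ m, N_T = m + 2 := ⟨N_T - 2, by omega⟩
  simp only [Nat.add_sub_cancel, show m + 2 - 1 = m + 1 by omega] at hjoint ⊢
  set dR : ℝ → ℝ := fun r => υ_f * r * Real.exp (-(π * lam_f * (r ^ 2 - R₂ ^ 2))) with hdR
  set μR : Measure ℝ := volume.withDensity (fun r =>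
    Set.indicator (Icc R₂ R₃) (fun r => ENNReal.ofReal (dR r)) r) with hμR
  change Measure.map (fun ω => (Y₂ ω, Y₃ ω, R ω)) ℙ = (gamM n).prod ((gamM m).prod μR) at hjoint
  have hdRc : Continuous dR := by rw [hdR]; fun_prop
  have hmeas : Measurable (fun r => Set.indicator (Icc R₂ R₃) (fun r => ENNReal.ofReal (dR r)) r) :=
    (hdRc.measurable.ennreal_ofReal).indicator measurableSet_Icc
  have hυp : 0 < υ_f := by
    rw [hυ]
    have h1 : 0 < π * lam_f * (R₃ ^ 2 - R₂ ^ 2) := by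
      have : 0 < R₃ ^ 2 - R₂ ^ 2 := by nlinarith
      have := Real.pi_pos
      positivity
    have h2 : Real.exp (-(π * lam_f * (R₃ ^ 2 - R₂ ^ 2))) < 1 := by
      rw [Real.exp_lt_one_iff]; linarith
    have h3 : 0 < 1 - Real.exp (-(π * lam_f * (R₃ ^ 2 - R₂ ^ 2))) := by linarith
    have := Real.pi_pos
    positivity
  have hT : Measurable (fun ω => (Y₂ ω, Y₃ ω, R ω)) := hY₂.prodMk (hY₃.prodMk hR)
  haveI hprobR : IsProbabilityMeasure μR := by
    constructor
    have h1 : Measure.map (fun ω => (Y₂ ω, Y₃ ω, R ω)) ℙ univ = 1 := by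
      rw [Measure.map_apply hT MeasurableSet.univ]; simp
    rw [hjoint, ← univ_prod_univ, Measure.prod_prod, ← univ_prod_univ, Measure.prod_prod] at h1
    simpa using h1
  have hRae : ∀ᵐ r ∂μR, r ∈ Icc R₂ R₃ := by
    rw [hμR, ae_withDensity_iff hmeas]
    refine Filter.Eventually.of_forall fun r hr => ?_
    by_contra hcon
    exact hr (indicator_of_notMem hcon _)
  have hA : ∀ A : Set ℝ, MeasurableSet A → ℙ {ω | Y₂ ω ∈ A} = gamM n A := by
    intro A hAm
    have h1 : Measure.map (fun ω => (Y₂ ω, Y₃ ω, R ω)) ℙ (A ×ˢ univ) = ℙ {ω | Y₂ ω ∈ A} := by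
      rw [Measure.map_apply hT (hAm.prod MeasurableSet.univ)]
      congr 1; ext ω; simp
    rw [← h1, hjoint, Measure.prod_prod]; simp
  have hB : ∀ B : Set (ℝ × ℝ), MeasurableSet B →
      ℙ {ω | (Y₃ ω, R ω) ∈ B} = ((gamM m).prod μR) B := by
    intro B hBm
    have h1 : Measure.map (fun ω => (Y₂ ω, Y₃ ω, R ω)) ℙ (univ ×ˢ B) = ℙ {ω | (Y₃ ω, R ω) ∈ B} := by
      rw [Measure.map_apply hT (MeasurableSet.univ.prod hBm)]
      congr 1; ext ω; simp
    rw [← h1, hjoint, Measure.prod_prod]; simp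
  have hc0 : 0 ≤ c := by
    rw [hc]
    have := Real.rpow_pos_of_pos hR₁ α
    have : 0 < a₂ - τ₂ * a₁ := by linarith
    positivity
  have hβ0 : 0 < β := by rw [hβ]; positivity
  set q : ℝ := Real.exp (-c) * ∑ k ∈ Finset.range (n + 1), c ^ k / (k.factorial : ℝ) with hq
  have hq0 : 0 ≤ q := by
    rw [hq]; positivity
  have hq1 : q ≤ 1 := by
    have := prob_le_one (μ := gamM n) (s := Ici c)
    rw [gamM_Ici n c hc0, ← hq] at this
    exact ENNReal.ofReal_le_one.1 this
  -- upper gamma ratio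
  have hug : upperGamma ((n + 1 : ℕ) : ℝ) c / Real.Gamma ((n + 1 : ℕ) : ℝ) = q := by
    rw [hq, ← gam_val n c hc0, upperGamma, integral_div]
    congr 1
    · refine setIntegral_congr_fun measurableSet_Ioi fun t _ => ?_
      simp
    · push_cast
      exact Real.Gamma_nat_eq_factorial n
  have hP1 : ℙ {ω | a₂ * V ω / (a₁ * V ω + 1) < τ₂} = 1 - ENNReal.ofReal q := by
    rw [hq, ← gamM_Ici n c hc0, ← gamM_Iio]
    have := hA {y | a₂ * (ρ_s * R₁ ^ (-α) * y) / (a₁ * (ρ_s * R₁ ^ (-α) * y) + 1) < τ₂}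
      (measurableSet_lt (by fun_prop) (by fun_prop))
    simp only [hV]
    refine this.trans (measure_congr ?_)
    filter_upwards [gamM_ae n] with y hy
    exact propext (hc ▸ (key_iff hρs hR₁ ha₁ hord hy rfl).1)
  have hP2 : ℙ {ω | a₂ * V ω / (a₁ * V ω + 1) > τ₂} = ENNReal.ofReal q := by
    rw [hq, ← gamM_Ioi n c hc0]
    have := hA {y | a₂ * (ρ_s * R₁ ^ (-α) * y) / (a₁ * (ρ_s * R₁ ^ (-α) * y) + 1) > τ₂}
      (measurableSet_lt (by fun_prop) (by fun_prop))
    simp only [hV]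
    refine this.trans (measure_congr ?_)
    filter_upwards [gamM_ae n] with y hy
    exact propext (hc ▸ (key_iff hρs hR₁ ha₁ hord hy rfl).2)
  set S : ℝ := υ_f * Real.exp (π * lam_f * R₂ ^ 2) *
          ∑ k ∈ Finset.range (m + 1),
            β ^ k / (Nat.factorial k : ℝ) *
              ∫ r in R₂..R₃,
                r ^ (α * k + 1) * Real.exp (-(β * r ^ α + π * lam_f * r ^ 2)) with hS
  let B : Set (ℝ × ℝ) := {p | β * p.2 ^ α ≤ p.1}
  have hBm : MeasurableSet B := measurableSet_le (by fun_prop) (by fun_prop)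
  let g : ℝ → ℝ := fun r => dR r * (Real.exp (-(β * r ^ α)) *
      ∑ k ∈ Finset.range (m + 1), (β * r ^ α) ^ k / (k.factorial : ℝ))
  have hαc : Continuous (fun r : ℝ => r ^ α) :=
    Real.continuous_rpow_const (by linarith)
  have hgc : Continuous g := by
    simp only [g]
    refine hdRc.mul (Continuous.mul (by fun_prop) ?_)
    refine continuous_finsetSum _ fun k _ => ?_
    fun_prop
  have hgS : ∫ r in R₂..R₃, g r = S := by
    rw [hS, Finset.mul_sum]
    have hgi : ∀ k : ℕ, IntervalIntegrable (fun r => υ_f * Real.exp (π * lam_f * R₂ ^ 2) *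
        (β ^ k / (Nat.factorial k : ℝ) *
          (r ^ (α * k + 1) * Real.exp (-(β * r ^ α + π * lam_f * r ^ 2))))) volume R₂ R₃ := by
      intro k
      have : Continuous (fun r : ℝ => r ^ (α * k + 1)) :=
        Real.continuous_rpow_const (by positivity)
      exact Continuous.intervalIntegrable (by fun_prop) _ _
    simp_rw [← intervalIntegral.integral_const_mul]
    rw [← intervalIntegral.integral_finsetSum (fun k _ => hgi k)]
    refine intervalIntegral.integral_congr fun r hr => ?_
    rw [uIcc_of_le hR₃.le] at hr
    have hr0 : 0 < r := lt_of_lt_of_le hR₂ hr.1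
    simp only [g, hdR]
    rw [Finset.mul_sum, Finset.mul_sum]
    refine Finset.sum_congr rfl fun k _ => ?_
    have e1 : r ^ (α * k + 1) = (r ^ α) ^ k * r := by
      rw [Real.rpow_add hr0, Real.rpow_one, Real.rpow_mul hr0.le, Real.rpow_natCast]
    have e2 : Real.exp (-(π * lam_f * (r ^ 2 - R₂ ^ 2))) =
        Real.exp (π * lam_f * R₂ ^ 2) * Real.exp (-(π * lam_f * r ^ 2)) := by
      rw [← Real.exp_add]; congr 1; ring
    have e3 : Real.exp (-(β * r ^ α + π * lam_f * r ^ 2)) =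
        Real.exp (-(β * r ^ α)) * Real.exp (-(π * lam_f * r ^ 2)) := by
      rw [← Real.exp_add]; congr 1; ring
    rw [e1, e2, e3, mul_pow]
    ring
  have hBval : ((gamM m).prod μR) B = ENNReal.ofReal S := by
    rw [Measure.prod_apply_symm hBm, hμR, lintegral_withDensity_eq_lintegral_mul _ hmeas
      (measurable_measure_prodMk_right hBm), ← hgS, intervalIntegral.integral_of_le hR₃.le,
      ← integral_Icc_eq_integral_Ioc, ofReal_integral_eq_lintegral_ofReal
        (hgc.continuousOn.integrableOn_Icc)]
    · rw [← lintegral_indicator measurableSet_Icc]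
      refine lintegral_congr fun r => ?_
      by_cases hr : r ∈ Icc R₂ R₃
      · have hr0 : 0 < r := lt_of_lt_of_le hR₂ hr.1
        have hra := Real.rpow_pos_of_pos hr0 α
        have hd0 : 0 ≤ dR r := by simp only [hdR]; positivity
        have : (fun x => (x, r)) ⁻¹' B = Ici (β * r ^ α) := by ext; simp [B]
        simp only [Pi.mul_apply, indicator_of_mem hr]
        rw [this, gamM_Ici _ _ (by positivity), ← ENNReal.ofReal_mul hd0]
      · simp only [Pi.mul_apply, indicator_of_notMem hr, zero_mul]
    · refine (ae_restrict_iff' measurableSet_Icc).2 (Filter.Eventually.of_forall fun r hr => ?_)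
      have hr0 : 0 < r := lt_of_lt_of_le hR₂ hr.1
      have hra := Real.rpow_pos_of_pos hr0 α
      simp only [Pi.zero_apply, g, hdR]
      positivity
  have hP3 : ℙ {ω | ρ_r * R ω ^ (-α) * Y₃ ω < τ₂} = 1 - ENNReal.ofReal S := by
    rw [← hBval, ← prob_compl_eq_one_sub hBm]
    have := hB {p | ρ_r * p.2 ^ (-α) * p.1 < τ₂} (measurableSet_lt (by fun_prop) (by fun_prop))
    refine this.trans (measure_congr ?_)
    have h2 : ∀ᵐ p ∂((gamM m).prod μR), p.2 ∈ Icc R₂ R₃ :=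
      Measure.quasiMeasurePreserving_snd.ae hRae
    filter_upwards [h2] with p hp
    have hr0 : 0 < p.2 := lt_of_lt_of_le hR₂ hp.1
    have hra := Real.rpow_pos_of_pos hr0 α
    refine propext ?_
    change ρ_r * p.2 ^ (-α) * p.1 < τ₂ ↔ ¬ (β * p.2 ^ α ≤ p.1)
    rw [not_le, hβ, Real.rpow_neg hr0.le]
    have e : ρ_r * (p.2 ^ α)⁻¹ * p.1 = p.1 * ρ_r / p.2 ^ α := by field_simp
    have e' : τ₂ / ρ_r * p.2 ^ α = τ₂ * p.2 ^ α / ρ_r := by ring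
    rw [e, e', div_lt_iff₀ hra, lt_div_iff₀ hρr]
  have hS0 : 0 ≤ S := by
    rw [← hgS]
    refine intervalIntegral.integral_nonneg hR₃.le fun r hr => ?_
    have hr0 : 0 < r := lt_of_lt_of_le hR₂ hr.1
    have hra := Real.rpow_pos_of_pos hr0 α
    simp only [g, hdR]
    positivity
  have hS1 : S ≤ 1 := by
    have := prob_le_one (μ := (gamM m).prod μR) (s := B)
    rw [hBval] at this
    exact ENNReal.ofReal_le_one.1 this
  rw [hP1, hP2, hP3, hug, mul_assoc, ← hS, ← ENNReal.ofReal_one, ← ENNReal.ofReal_sub _ hq0,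
    ← ENNReal.ofReal_sub _ hS0, ← ENNReal.ofReal_mul hq0,
    ← ENNReal.ofReal_add (by linarith) (mul_nonneg hq0 (by linarith))]
  congr 1
  ring
end

section
/- Let N_T ≥ 2 be an integer, let β, λ_f > 0, and let 0 < R₂ < R₃. Let Y₃ and R be independent random variables where Y₃ has probability density x^{N_T−2}e^{−x}/(N_T−2)! on [0,∞) and R has probability density υ_f · r · e^{−πλ_f(r² − R₂²)} on [R₂, R₃] with υ_f = 2πλ_f/(1 − e^{−πλ_f(R₃² − R₂²)}). Then P( Y₃ < β R² ) = 1 − (b₅/2) · Σ_{k=0}^{N_T−2} β^k · ( H(R₂) − H(R₃) ), where b₅ = υ_f e^{πλ_f R₂²}, δ = β + πλ_f, and H(x) = e^{−δx²} · Σ_{j=0}^{k} x^{2j}/(j! · δ^{k+1−j}). -/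
open MeasureTheory Real Set

lemma aux_conv {f g : ℝ → ℝ} {f' g' x : ℝ} (h : HasDerivAt f f' x) (hf : ∀ y, g y = f y)
    (hd : g' = f') : HasDerivAt g g' x := by
  obtain rfl : g = f := funext hf
  exact hd ▸ h

lemma aux_deriv (c : ℝ) (hc : c ≠ 0) (k : ℕ) (t : ℝ) :
    HasDerivAt (fun t : ℝ => Real.exp (-(c * t)) *
      ∑ j ∈ Finset.range (k + 1), t ^ j / ((Nat.factorial j : ℝ) * c ^ (k + 1 - j)))
      (-(Real.exp (-(c * t)) * t ^ k / (Nat.factorial k : ℝ))) t := by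
  have he : HasDerivAt (fun t : ℝ => Real.exp (-(c * t))) (Real.exp (-(c * t)) * (-(c * 1))) t :=
    (((hasDerivAt_id t).const_mul c).neg).exp
  induction k with
  | zero =>
    have := he.mul_const (1 / c)
    simp only [Nat.factorial] at this ⊢
    refine aux_conv this ?_ ?_
    · intro x; simp
    · field_simp; simp
  | succ k ih =>
    have h2 := (ih.div_const c).add
      (he.mul ((hasDerivAt_pow (k + 1) t).div_const ((Nat.factorial (k + 1) : ℝ) * c)))
    refine aux_conv h2 ?_ ?_
    · intro x
      simp only [Pi.add_apply, Pi.mul_apply]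
      rw [Finset.sum_range_succ, mul_add, mul_div_assoc, Finset.sum_div]
      congr 2
      · apply Finset.sum_congr rfl
        intro j hj
        have hj' : j < k + 1 := Finset.mem_range.mp hj
        rw [show k + 1 + 1 - j = (k + 1 - j) + 1 by omega, pow_succ, div_div, mul_assoc]
      · simp
    · have hf : (Nat.factorial k : ℝ) ≠ 0 := by positivity
      have hk : (k : ℝ) + 1 ≠ 0 := by positivity
      simp only [Nat.factorial_succ]
      push_cast
      try simp only [Nat.add_sub_cancel]
      field_simp
      ring

lemma aux_lint (a b : ℝ) (hab : a ≤ b) (F f : ℝ → ℝ) (hF : ∀ x, HasDerivAt F (f x) x)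
    (hf : Continuous f) (h0 : ∀ x ∈ Icc a b, 0 ≤ f x) :
    ∫⁻ x in Icc a b, ENNReal.ofReal (f x) = ENNReal.ofReal (F b - F a) := by
  rw [← ofReal_integral_eq_lintegral_ofReal (hf.integrableOn_Icc)
    ((ae_restrict_iff' measurableSet_Icc).2 (Filter.Eventually.of_forall h0)),
    integral_Icc_eq_integral_Ioc, ← intervalIntegral.integral_of_le hab,
    intervalIntegral.integral_eq_sub_of_hasDerivAt (fun x _ => hF x)
      (hf.intervalIntegrable _ _)]

lemma aux_G_nonneg (n : ℕ) (y : ℝ) (hy : 0 ≤ y) :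
    0 ≤ 1 - Real.exp (-y) * ∑ k ∈ Finset.range n, y ^ k / (Nat.factorial k : ℝ) := by
  have h := Real.sum_le_exp_of_nonneg hy n
  have h2 := mul_le_mul_of_nonneg_left h (Real.exp_pos (-y)).le
  rw [← Real.exp_add] at h2
  simp at h2
  linarith

lemma aux_Y (n : ℕ) (y : ℝ) (hy : 0 ≤ y) :
    (volume.withDensity (fun x =>
          Set.indicator (Ici (0 : ℝ))
            (fun x => ENNReal.ofReal
              (x ^ n * Real.exp (-x) / (Nat.factorial n : ℝ))) x)) (Iio y) =
    ENNReal.ofReal (1 - Real.exp (-y) *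
      ∑ k ∈ Finset.range (n + 1), y ^ k / (Nat.factorial k : ℝ)) := by
  rw [withDensity_apply _ measurableSet_Iio, setLIntegral_indicator measurableSet_Ici,
    Ici_inter_Iio, setLIntegral_congr Ico_ae_eq_Icc,
    aux_lint 0 y hy (fun t => -(Real.exp (-(1 * t)) *
      ∑ j ∈ Finset.range (n + 1), t ^ j / ((Nat.factorial j : ℝ) * 1 ^ (n + 1 - j))))]
  · congr 1
    simp only [one_pow, mul_one, one_mul]
    have : ∑ j ∈ Finset.range (n + 1), (0 : ℝ) ^ j / (Nat.factorial j : ℝ) = 1 := by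
      rw [Finset.sum_range_succ']
      simp
    rw [this]
    simp
    ring
  · intro x
    refine aux_conv (aux_deriv 1 one_ne_zero n x).neg (fun _ => rfl) ?_
    simp
    ring
  · fun_prop
  · intro x hx
    have := hx.1
    positivity

/-- Corollary 4, second-hop factor, NNNF far user, `α = 2`: with
`Y₃ ∼ χ²(2(N_T−1))/2` and `R` the nearest-far-user distance with density
`υ_f r e^{−πλ_f(r² − R₂²)}` on `[R₂, R₃]`, independent,
`P(Y₃ < βR²) = 1 − (b₅/2) Σ_{k=0}^{N_T−2} β^k (H_k(R₂) − H_k(R₃))` where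
`b₅ = υ_f e^{πλ_f R₂²}`, `δ = β + πλ_f`, `H_k(x) = e^{−δx²} Σ_{j=0}^k x^{2j}/(j! δ^{k+1−j})`. -/
theorem stmt_14
    {Ω : Type*} [MeasurableSpace Ω] (ℙ : Measure Ω) [IsProbabilityMeasure ℙ]
    (β lam_f R₂ R₃ : ℝ) (N_T : ℕ)
    (hNT : 2 ≤ N_T) (hβ : 0 < β) (hlam : 0 < lam_f) (hR₂ : 0 < R₂) (hR₃ : R₂ < R₃)
    (υ_f : ℝ) (hυ : υ_f = 2 * π * lam_f / (1 - Real.exp (-(π * lam_f * (R₃ ^ 2 - R₂ ^ 2)))))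
    (Y₃ R : Ω → ℝ) (hY₃ : Measurable Y₃) (hR : Measurable R)
    (hjoint : Measure.map (fun ω => (Y₃ ω, R ω)) ℙ =
      (volume.withDensity (fun x =>
          Set.indicator (Ici (0 : ℝ))
            (fun x => ENNReal.ofReal
              (x ^ (N_T - 2) * Real.exp (-x) / (Nat.factorial (N_T - 2) : ℝ))) x)).prod
        (volume.withDensity (fun r =>
          Set.indicator (Icc R₂ R₃)
            (fun r => ENNReal.ofReal
              (υ_f * r * Real.exp (-(π * lam_f * (r ^ 2 - R₂ ^ 2))))) r)))
    (δ : ℝ) (hδ : δ = β + π * lam_f)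
    (H : ℕ → ℝ → ℝ)
    (hH : H = fun k x => Real.exp (-(δ * x ^ 2)) *
      ∑ j ∈ Finset.range (k + 1), x ^ (2 * j) / ((Nat.factorial j : ℝ) * δ ^ (k + 1 - j))) :
    ℙ {ω | Y₃ ω < β * R ω ^ 2} =
      ENNReal.ofReal
        (1 - υ_f * Real.exp (π * lam_f * R₂ ^ 2) / 2 *
          ∑ k ∈ Finset.range (N_T - 1), β ^ k * (H k R₂ - H k R₃)) := by
  obtain ⟨n, rfl⟩ : ∃ n, N_T = n + 2 := ⟨N_T - 2, by omega⟩
  simp only [Nat.add_sub_cancel] at hjoint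
  rw [show n + 2 - 1 = n + 1 by omega]
  have hpl : 0 < π * lam_f := mul_pos Real.pi_pos hlam
  have hδ0 : 0 < δ := by rw [hδ]; positivity
  have hE : Real.exp (-(π * lam_f * (R₃ ^ 2 - R₂ ^ 2))) < 1 := by
    rw [Real.exp_lt_one_iff]
    have : 0 < R₃ ^ 2 - R₂ ^ 2 := by nlinarith
    have := mul_pos hpl this
    linarith
  have hυ0 : 0 < υ_f := by
    rw [hυ]
    apply div_pos (by positivity) (by linarith)
  have hS : MeasurableSet {p : ℝ × ℝ | p.1 < β * p.2 ^ 2} :=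
    measurableSet_lt (by fun_prop) (by fun_prop)
  have h1 : ℙ {ω | Y₃ ω < β * R ω ^ 2} =
      Measure.map (fun ω => (Y₃ ω, R ω)) ℙ {p : ℝ × ℝ | p.1 < β * p.2 ^ 2} := by
    rw [Measure.map_apply (hY₃.prodMk hR) hS]
    rfl
  have hm : Measurable (fun r => Set.indicator (Icc R₂ R₃)
            (fun r => ENNReal.ofReal
              (υ_f * r * Real.exp (-(π * lam_f * (r ^ 2 - R₂ ^ 2))))) r) :=
    Measurable.indicator (by fun_prop) measurableSet_Icc
  have h2 : ∀ r : ℝ, (fun x : ℝ => (x, r)) ⁻¹' {p : ℝ × ℝ | p.1 < β * p.2 ^ 2} = Iio (β * r ^ 2) :=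
    fun r => rfl
  have h3 : ∀ r : ℝ, 0 ≤ β * r ^ 2 := fun r => by positivity
  rw [h1, hjoint, Measure.prod_apply_symm hS]
  simp only [h2, aux_Y n _ (h3 _)]
  rw [lintegral_withDensity_eq_lintegral_mul _ hm (by fun_prop)]
  have h4 : ∀ r : ℝ, ((fun r => Set.indicator (Icc R₂ R₃)
            (fun r => ENNReal.ofReal
              (υ_f * r * Real.exp (-(π * lam_f * (r ^ 2 - R₂ ^ 2))))) r) *
      (fun r => ENNReal.ofReal (1 - Real.exp (-(β * r ^ 2)) *
        ∑ k ∈ Finset.range (n + 1), (β * r ^ 2) ^ k / (Nat.factorial k : ℝ)))) r =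
      Set.indicator (Icc R₂ R₃) (fun r => ENNReal.ofReal
        (υ_f * r * Real.exp (-(π * lam_f * (r ^ 2 - R₂ ^ 2))) *
        (1 - Real.exp (-(β * r ^ 2)) *
        ∑ k ∈ Finset.range (n + 1), (β * r ^ 2) ^ k / (Nat.factorial k : ℝ)))) r := by
    intro r
    by_cases hr : r ∈ Icc R₂ R₃
    · have : 0 ≤ r := hR₂.le.trans hr.1
      simp only [Pi.mul_apply, indicator_of_mem hr]
      rw [← ENNReal.ofReal_mul (by positivity)]
    · simp [hr]
  rw [lintegral_congr h4, lintegral_indicator measurableSet_Icc]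
  have hHd : ∀ k x, HasDerivAt (H k)
      (-(Real.exp (-(δ * x ^ 2)) * (x ^ 2) ^ k / (Nat.factorial k : ℝ)) * (2 * x)) x := by
    intro k x
    have h := HasDerivAt.comp x (aux_deriv δ hδ0.ne' k (x ^ 2)) (hasDerivAt_pow 2 x)
    rw [hH]
    refine aux_conv h ?_ ?_
    · intro y
      simp [pow_mul]
    · simp
  rw [aux_lint R₂ R₃ hR₃.le (fun r => -(υ_f / (2 * (π * lam_f))) *
      Real.exp (-(π * lam_f * (r ^ 2 - R₂ ^ 2))) +
      υ_f * Real.exp (π * lam_f * R₂ ^ 2) / 2 * ∑ k ∈ Finset.range (n + 1), β ^ k * H k r)]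
  · congr 1
    simp only [mul_sub, Finset.sum_sub_distrib]
    have hne : 1 - Real.exp (-(π * lam_f * (R₃ ^ 2 - R₂ ^ 2))) ≠ 0 := by linarith
    have : υ_f / (2 * (π * lam_f)) * (1 - Real.exp (-(π * lam_f * (R₃ ^ 2 - R₂ ^ 2)))) = 1 := by
      rw [hυ]
      have := Real.pi_pos.ne'
      have := hlam.ne'
      generalize Real.exp (-(π * lam_f * (R₃ ^ 2 - R₂ ^ 2))) = E at *
      field_simp
    simp only [mul_sub] at this
    simp only [sub_self, neg_zero, Real.exp_zero]
    linarith
  · intro x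
    have hg : HasDerivAt (fun r : ℝ => Real.exp (-(π * lam_f * (r ^ 2 - R₂ ^ 2))))
        (Real.exp (-(π * lam_f * (x ^ 2 - R₂ ^ 2))) * (-(π * lam_f * (2 * x)))) x := by
      have := ((((hasDerivAt_pow 2 x).sub_const (R₂ ^ 2)).const_mul (π * lam_f)).neg).exp
      simpa using this
    have hs : HasDerivAt (fun r => ∑ k ∈ Finset.range (n + 1), β ^ k * H k r)
        (∑ k ∈ Finset.range (n + 1), β ^ k *
          (-(Real.exp (-(δ * x ^ 2)) * (x ^ 2) ^ k / (Nat.factorial k : ℝ)) * (2 * x))) x :=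
      HasDerivAt.fun_sum (fun k _ => (hHd k x).const_mul _)
    refine ((hg.const_mul _).add (hs.const_mul _)).congr_deriv ?_
    have e1 : ∑ k ∈ Finset.range (n + 1), β ^ k *
          (-(Real.exp (-(δ * x ^ 2)) * (x ^ 2) ^ k / (Nat.factorial k : ℝ)) * (2 * x)) =
        -(2 * x) * Real.exp (-(δ * x ^ 2)) *
          ∑ k ∈ Finset.range (n + 1), (β * x ^ 2) ^ k / (Nat.factorial k : ℝ) := by
      rw [Finset.mul_sum]
      refine Finset.sum_congr rfl fun k _ => ?_
      rw [mul_pow]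
      ring
    have e2 : Real.exp (π * lam_f * R₂ ^ 2) * Real.exp (-(δ * x ^ 2)) =
        Real.exp (-(π * lam_f * (x ^ 2 - R₂ ^ 2))) * Real.exp (-(β * x ^ 2)) := by
      rw [← Real.exp_add, ← Real.exp_add, hδ]
      congr 1
      ring
    rw [e1]
    generalize ∑ k ∈ Finset.range (n + 1), (β * x ^ 2) ^ k / (Nat.factorial k : ℝ) = S
    have e3 : -(υ_f / (2 * (π * lam_f))) *
        (Real.exp (-(π * lam_f * (x ^ 2 - R₂ ^ 2))) * (-(π * lam_f * (2 * x)))) =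
        υ_f * x * Real.exp (-(π * lam_f * (x ^ 2 - R₂ ^ 2))) := by
      generalize π * lam_f = c at *
      have := hpl.ne'
      generalize Real.exp (-(c * (x ^ 2 - R₂ ^ 2))) = E
      field_simp
    rw [e3]
    linear_combination (-(υ_f * x * S)) * e2
  · fun_prop
  · intro r hr
    have : 0 ≤ r := hR₂.le.trans hr.1
    exact mul_nonneg (by positivity) (aux_G_nonneg _ _ (h3 r))
end
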